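/- Fix e ∈ S^n ⊂ ℝ^{n+1} and identify e^⊥ with ℝ^n. Let n+1 ≤ k ≤ 2n², let u_1,…,u_k ∈ S^{n−1} ⊂ e^⊥ and c_1,…,c_k > 0 satisfy Σ_{i=1}^k c_i u_i⊗u_i = Id_n and Σ_{i=1}^k c_i u_i = 0, and set ũ_i = √(n/(n+1)) u_i + (1/√(n+1)) e and c̃_i = ((n+1)/n) c_i. Let s ∈ [0, 0.15], ρ ∈ (0,1), and g̃_s(t) = 1{t ≥ 0}·e^{−(t−s)²/2}. Suppose that for every choice of unit vectors w_1,…,w_{n+1} ∈ S^{n−1} forming the vertices of a regular simplex (pairwise inner products −1/n) and every subset {i_1,…,i_{n+1}} ⊆ {1,…,k}, there exists j ∈ {1,…,n+1} with ∠(u_{i_j}, w_j) ≥ ρ. Then ∫_{ℝ^{n+1}} Π_{i=1}^k g̃_s(⟨x, ũ_i⟩)^{c̃_i} dx ≤ (1 − n^{−56n}ρ⁴)·(∫_ℝ g̃_s)^{n+1}, and the upper integral ∫*_{ℝ^{n+1}} sup{ Π_{i=1}^k g̃_s(θ_i)^{c̃_i} : θ_1,…,θ_k ∈ ℝ, x =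 Σ_{i=1}^k c̃_i θ_i ũ_i } dx ≥ (1 + n^{−56n}ρ⁴)·(∫_ℝ g̃_s)^{n+1}. -/

import Mathlib

open MeasureTheory Metric Set
open scoped RealInnerProductSpace ENNReal

noncomputable section

/-- The (unnormalized) truncated Gaussian `g̃_s(t) = 1{t ≥ 0}·e^{−(t−s)²/2}`. -/
def truncGaussU (s t : ℝ) : ℝ :=
  if 0 ≤ t then Real.exp (-(t - s) ^ 2 / 2) else 0

/-- The upper integral of a (possibly nonmeasurable) nonnegative function: the infimum of the
integrals of measurable functions dominating it. -/
def upperIntegral {α : Type*} [MeasurableSpace α] (μ : Measure α) (f : α → ℝ≥0∞) : ℝ≥0∞ :=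
  ⨅ (g : α → ℝ≥0∞) (_ : Measurable g) (_ : ∀ x, f x ≤ g x), ∫⁻ x, g x ∂μ

lemma log_gain {x a M : ℝ} (hx : 0 < x) (ha : 0 < a) (hxM : x ≤ M) (haM : a ≤ M) :
    Real.log x ≤ Real.log a + (x - a) / a - (x - a) ^ 2 / (4 * M ^ 2) := by
  have hM : 0 < M := lt_of_lt_of_le hx hxM
  obtain ⟨p, hp, rfl⟩ : ∃ p : ℝ, 0 < p ∧ p ^ 2 = x :=
    ⟨√x, Real.sqrt_pos.2 hx, Real.sq_sqrt hx.le⟩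
  obtain ⟨q, hq, rfl⟩ : ∃ q : ℝ, 0 < q ∧ q ^ 2 = a :=
    ⟨√a, Real.sqrt_pos.2 ha, Real.sq_sqrt ha.le⟩
  have h1 : Real.log (p / q) ≤ p / q - 1 := Real.log_le_sub_one_of_pos (by positivity)
  have h2 : Real.log (p ^ 2) - Real.log (q ^ 2) = 2 * Real.log (p / q) := by
    rw [Real.log_div hp.ne' hq.ne', Real.log_pow, Real.log_pow]; push_cast; ring
  have h3 : (p ^ 2 - q ^ 2) / q ^ 2 - 2 * (p / q - 1) = (p - q) ^ 2 / q ^ 2 := by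
    field_simp; ring
  have h4 : (p ^ 2 - q ^ 2) ^ 2 / (4 * M ^ 2) ≤ (p - q) ^ 2 / q ^ 2 := by
    rw [div_le_div_iff₀ (by positivity) (by positivity)]
    have h5 : (p + q) ^ 2 ≤ 4 * M := by nlinarith [sq_nonneg (p - q)]
    have h6 : (p + q) ^ 2 * q ^ 2 ≤ 4 * M * M := by
      apply mul_le_mul h5 haM (by positivity) (by positivity)
    have : (p ^ 2 - q ^ 2) ^ 2 * q ^ 2 = (p - q) ^ 2 * ((p + q) ^ 2 * q ^ 2) := by ring
    rw [this]
    apply le_trans (mul_le_mul_of_nonneg_left h6 (sq_nonneg _))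
    apply le_of_eq; ring
  linarith

section frame

variable {ι E : Type*} [Fintype ι] [NormedAddCommGroup E] [InnerProductSpace ℝ E]

/-- The frame operator with weights `t`. -/
def frameOp (u : ι → E) (c t : ι → ℝ) : E →L[ℝ] E :=
  ∑ i, (c i * t i) • (innerSL ℝ (u i)).smulRight (u i)

lemma frameOp_apply (u : ι → E) (c t : ι → ℝ) (x : E) :
    frameOp u c t x = ∑ i, (c i * t i * ⟪u i, x⟫) • u i := by
  simp [frameOp, smul_smul]

lemma frameOp_inner (u : ι → E) (c t : ι → ℝ) (x y : E) :
    ⟪frameOp u c t x, y⟫ = ∑ i, c i * t i * ⟪u i, x⟫ * ⟪u i, y⟫ := by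
  simp [frameOp_apply, sum_inner, inner_smul_left]

lemma frameOp_symm (u : ι → E) (c t : ι → ℝ) (x y : E) :
    ⟪frameOp u c t x, y⟫ = ⟪x, frameOp u c t y⟫ := by
  rw [real_inner_comm (frameOp u c t y) x, frameOp_inner, frameOp_inner]
  exact Finset.sum_congr rfl fun i _ => by ring

lemma frame_gain [FiniteDimensional ℝ E] {u : ι → E} {c t : ι → ℝ} {M : ℝ}
    (hu : ∀ i, ‖u i‖ = 1) (hc : ∀ i, 0 < c i)
    (hiso : ∀ x : E, ∑ i, c i * ⟪u i, x⟫ ^ 2 = ‖x‖ ^ 2)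
    (ht : ∀ i, 0 < t i) (htM : ∀ i, t i ≤ M) :
    (∏ i, t i ^ c i) *
      (1 + (4 * M ^ 2)⁻¹ * ∑ i, c i * ‖frameOp u c t (u i) - t i • u i‖ ^ 2) ≤
      (frameOp u c t).det := by
  set A := frameOp u c t with hA
  have hsym : (A : E →ₗ[ℝ] E).IsSymmetric := fun x y => frameOp_symm u c t x y
  set v := hsym.eigenvectorBasis rfl with hv
  set a := hsym.eigenvalues rfl with ha
  have hAv : ∀ j, A (v j) = a j • v j := fun j => hsym.apply_eigenvectorBasis rfl j
  have hcp : ∀ j, ∑ i, c i * ⟪u i, v j⟫ ^ 2 = 1 := fun j => by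
    rw [hiso, v.norm_eq_one]; norm_num
  have hp : ∀ i, ∑ j, ⟪u i, v j⟫ ^ 2 = 1 := fun i => by
    have := v.sum_sq_inner_right (u i)
    rw [hu] at this
    simpa [real_inner_comm] using this
  have haj : ∀ j, a j = ∑ i, c i * ⟪u i, v j⟫ ^ 2 * t i := fun j => by
    have h1 : ⟪A (v j), v j⟫ = a j := by
      rw [hAv, inner_smul_left, real_inner_self_eq_norm_sq, v.norm_eq_one]; simp
    rw [← h1, hA, frameOp_inner]
    exact Finset.sum_congr rfl fun i _ => by ring
  have hapos : ∀ j, 0 < a j := fun j => by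
    rw [haj]
    have hne : ∃ i, ⟪u i, v j⟫ ≠ 0 := by
      by_contra! h
      have := hcp j
      simp [h] at this
    obtain ⟨i, hi⟩ := hne
    refine Finset.sum_pos' (fun i _ => ?_) ⟨i, Finset.mem_univ _, ?_⟩
    · have := hc i; have := ht i; positivity
    · have := hc i; have := ht i; positivity
  have haM : ∀ j, a j ≤ M := fun j => by
    rw [haj]
    calc _ ≤ ∑ i, c i * ⟪u i, v j⟫ ^ 2 * M := by
          apply Finset.sum_le_sum; intro i _
          have := hc i; have := htM i; gcongr
      _ = M := by rw [← Finset.sum_mul, hcp, one_mul]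
  have hX : ∀ i, ‖A (u i) - t i • u i‖ ^ 2 = ∑ j, (t i - a j) ^ 2 * ⟪u i, v j⟫ ^ 2 := fun i => by
    rw [← v.sum_sq_inner_right]
    refine Finset.sum_congr rfl fun j _ => ?_
    rw [inner_sub_right, inner_smul_right, ← frameOp_symm u c t, ← hA, hAv, inner_smul_left,
      real_inner_comm (v j) (u i)]
    simp; ring
  have hkey : ∑ i, c i * Real.log (t i) +
      (4 * M ^ 2)⁻¹ * ∑ i, c i * ‖A (u i) - t i • u i‖ ^ 2 ≤ ∑ j, Real.log (a j) := by
    have h1 : ∀ j, Real.log (a j) ≥ ∑ i, (c i * ⟪u i, v j⟫ ^ 2 * Real.log (t i) +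
        c i * ⟪u i, v j⟫ ^ 2 * ((t i - a j) ^ 2 / (4 * M ^ 2))) := fun j => by
      have h2 : ∑ i, c i * ⟪u i, v j⟫ ^ 2 * ((t i - a j) / a j) = 0 := by
        have : ∀ i, c i * ⟪u i, v j⟫ ^ 2 * ((t i - a j) / a j) =
          (c i * ⟪u i, v j⟫ ^ 2 * t i - c i * ⟪u i, v j⟫ ^ 2 * a j) / a j := fun i => by ring
        simp_rw [this]
        rw [← Finset.sum_div, Finset.sum_sub_distrib, ← haj, ← Finset.sum_mul, hcp]; simp
      have h3 : Real.log (a j) = ∑ i, c i * ⟪u i, v j⟫ ^ 2 * Real.log (a j) := by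
        rw [← Finset.sum_mul, hcp, one_mul]
      rw [h3, ← add_zero (∑ i, c i * ⟪u i, v j⟫ ^ 2 * Real.log (a j)), ← h2,
        ← Finset.sum_add_distrib]
      apply Finset.sum_le_sum; intro i _
      have h4 := log_gain (ht i) (hapos j) (htM i) (haM j)
      have h5 : 0 ≤ c i * ⟪u i, v j⟫ ^ 2 := by have := hc i; positivity
      have := mul_le_mul_of_nonneg_left h4 h5
      linarith
    refine le_trans (le_of_eq ?_) (Finset.sum_le_sum fun j _ => h1 j)
    rw [Finset.sum_comm]
    simp_rw [Finset.sum_add_distrib]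
    congr 1
    · refine Finset.sum_congr rfl fun i _ => ?_
      rw [← Finset.sum_mul, ← Finset.mul_sum, hp, mul_one]
    · rw [Finset.mul_sum]
      refine Finset.sum_congr rfl fun i _ => ?_
      rw [hX, Finset.mul_sum, Finset.mul_sum]
      refine Finset.sum_congr rfl fun j _ => ?_
      rw [div_eq_mul_inv]; ring
  have hdet : A.det = Real.exp (∑ j, Real.log (a j)) := by
    rw [Real.exp_sum]
    have := hsym.det_eq_prod_eigenvalues rfl
    rw [ContinuousLinearMap.det, this]
    refine Finset.prod_congr rfl fun j _ => ?_
    rw [Real.exp_log (hapos j)]; rfl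
  rw [hdet]
  refine le_trans ?_ (Real.exp_le_exp.2 hkey)
  rw [Real.exp_add, Real.exp_sum]
  have : ∏ i, t i ^ c i = ∏ i, Real.exp (c i * Real.log (t i)) :=
    Finset.prod_congr rfl fun i _ => by rw [Real.rpow_def_of_pos (ht i), mul_comm]
  rw [this]
  apply mul_le_mul_of_nonneg_left _ (Finset.prod_nonneg fun i _ => (Real.exp_pos _).le)
  have := Real.add_one_le_exp ((4 * M ^ 2)⁻¹ * ∑ i, c i * ‖A (u i) - t i • u i‖ ^ 2)
  linarith

lemma frame_gain_pair [FiniteDimensional ℝ E] {u : ι → E} {c t : ι → ℝ} {M d : ℝ}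
    (hu : ∀ i, ‖u i‖ = 1) (hc : ∀ i, 0 < c i)
    (hiso : ∀ x : E, ∑ i, c i * ⟪u i, x⟫ ^ 2 = ‖x‖ ^ 2)
    (ht : ∀ i, 0 < t i) (htM : ∀ i, t i ≤ M) {a b : ι} (hab : a ≠ b) (hd : 0 ≤ d)
    (ha : d ≤ c a) (hb : d ≤ c b) :
    (∏ i, t i ^ c i) *
      (1 + (8 * M ^ 2)⁻¹ * d * ⟪u a, u b⟫ ^ 2 * (t a - t b) ^ 2) ≤
      (frameOp u c t).det := by
  classical
  refine le_trans ?_ (frame_gain hu hc hiso ht htM)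
  apply mul_le_mul_of_nonneg_left _
    (Finset.prod_nonneg fun i _ => Real.rpow_nonneg (ht i).le _)
  set A := frameOp u c t with hA
  set X : ι → ℝ := fun i => ‖A (u i) - t i • u i‖ with hX
  have h1 : |(t b - t a) * ⟪u a, u b⟫| ≤ X a + X b := by
    have e1 : (t b - t a) * ⟪u a, u b⟫ =
        ⟪A (u a) - t a • u a, u b⟫ - ⟪u a, A (u b) - t b • u b⟫ := by
      rw [inner_sub_left, inner_sub_right, inner_smul_left, inner_smul_right, hA, frameOp_symm]
      simp; ring
    rw [e1]
    have e2 := abs_real_inner_le_norm (A (u a) - t a • u a) (u b)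
    have e3 := abs_real_inner_le_norm (u a) (A (u b) - t b • u b)
    rw [hu] at e2 e3
    have e4 := abs_sub (⟪A (u a) - t a • u a, u b⟫) (⟪u a, A (u b) - t b • u b⟫)
    simp only [hX]
    linarith
  have h2 : d * (X a ^ 2 + X b ^ 2) ≤ ∑ i, c i * X i ^ 2 := by
    calc d * (X a ^ 2 + X b ^ 2) ≤ c a * X a ^ 2 + c b * X b ^ 2 := by
          have := mul_le_mul_of_nonneg_right ha (sq_nonneg (X a))
          have := mul_le_mul_of_nonneg_right hb (sq_nonneg (X b))
          linarith
      _ = ∑ i ∈ {a, b}, c i * X i ^ 2 := by rw [Finset.sum_pair hab]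
      _ ≤ _ := Finset.sum_le_sum_of_subset_of_nonneg (Finset.subset_univ _)
          fun i _ _ => by have := hc i; positivity
  have h3 : ⟪u a, u b⟫ ^ 2 * (t a - t b) ^ 2 ≤ 2 * (X a ^ 2 + X b ^ 2) := by
    have := sq_le_sq' (by linarith [abs_nonneg ((t b - t a) * ⟪u a, u b⟫)]) h1
    rw [sq_abs] at this
    nlinarith [sq_nonneg (X a - X b)]
  have h4 : (0:ℝ) ≤ (8 * M ^ 2)⁻¹ := by positivity
  have h5 : (4 * M ^ 2)⁻¹ = 2 * (8 * M ^ 2)⁻¹ := by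
    rw [show (8 * M ^ 2) = 2 * (4 * M ^ 2) by ring, mul_inv (2:ℝ)]; ring
  rw [h5]
  have h6 := mul_le_mul_of_nonneg_left (mul_le_mul_of_nonneg_left h3 hd) h4
  have h7 := mul_le_mul_of_nonneg_left h2 h4
  nlinarith


/-- Domain of the transport map. -/
def slab (u : ι → E) (I : Set ℝ) : Set E := {x | ∀ i, ⟪x, u i⟫ ∈ I}

lemma isOpen_slab (u : ι → E) {I : Set ℝ} (hI : IsOpen I) : IsOpen (slab u I) := by
  have : slab u I = ⋂ i, (fun x : E => ⟪x, u i⟫) ⁻¹' I := by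
    ext x; simp [slab]
  rw [this]
  exact isOpen_iInter_of_finite fun i => hI.preimage (by fun_prop)

lemma barthe_core [FiniteDimensional ℝ E] [MeasurableSpace E] [BorelSpace E]
    {u : ι → E} {c : ι → ℝ} (hc : ∀ i, 0 < c i)
    (hiso : ∀ x : E, ∑ i, c i * ⟪u i, x⟫ ^ 2 = ‖x‖ ^ 2)
    {I : Set ℝ} (hI : IsOpen I) {T T' f h : ℝ → ℝ}
    (hT : ∀ t ∈ I, HasDerivAt T (T' t) t) (hT' : ∀ t ∈ I, 0 < T' t) (hmono : StrictMonoOn T I)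
    (hh : ∀ y, 0 ≤ h y) (hf : ∀ t ∈ I, f t = h (T t) * T' t)
    {H : E → ℝ≥0∞}
    (hH : ∀ x ∈ slab u I, ENNReal.ofReal (∏ i, h (T ⟪x, u i⟫) ^ c i) ≤
      H (∑ i, (c i * T ⟪x, u i⟫) • u i))
    {G : E → ℝ}
    (hG : ∀ x ∈ slab u I, (∏ i, T' ⟪x, u i⟫ ^ c i) * (1 + G x) ≤
      (frameOp u c (fun i => T' ⟪x, u i⟫)).det) :
    ∫⁻ x in slab u I, ENNReal.ofReal ((∏ i, f ⟪x, u i⟫ ^ c i) * (1 + G x)) ≤ ∫⁻ x, H x := by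
  set Θ : E → E := fun x => ∑ i, (c i * T ⟪x, u i⟫) • u i with hΘ
  have hder : ∀ x ∈ slab u I, HasFDerivWithinAt Θ (frameOp u c (fun i => T' ⟪x, u i⟫))
      (slab u I) x := by
    intro x hx
    apply HasFDerivAt.hasFDerivWithinAt
    have : ∀ i, HasFDerivAt (fun x => (c i * T ⟪x, u i⟫) • u i)
        ((c i * T' ⟪x, u i⟫) • (innerSL ℝ (u i)).smulRight (u i)) x := by
      intro i
      have h1 : HasFDerivAt (fun x : E => ⟪x, u i⟫) (innerSL ℝ (u i)) x := by
        have := (innerSL ℝ (u i)).hasFDerivAt (x := x)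
        refine this.congr_of_eventuallyEq (Filter.Eventually.of_forall fun y => ?_)
        simp [real_inner_comm]
      have h2 := (((hT _ (hx i)).comp_hasFDerivAt x h1).const_mul (c i)).smul_const (u i)
      refine h2.congr_fderiv ?_
      ext y
      simp [smul_smul, mul_assoc]
    exact HasFDerivAt.fun_sum fun i _ => this i
  have hinj : InjOn Θ (slab u I) := by
    intro x hx y hy hxy
    by_contra hne
    have h0 : ⟪Θ x - Θ y, x - y⟫ = 0 := by rw [hxy, sub_self, inner_zero_left]
    have h1 : ⟪Θ x - Θ y, x - y⟫ =
        ∑ i, c i * ((T ⟪x, u i⟫ - T ⟪y, u i⟫) * (⟪x, u i⟫ - ⟪y, u i⟫)) := by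
      simp only [hΘ]
      rw [← Finset.sum_sub_distrib, sum_inner]
      refine Finset.sum_congr rfl fun i _ => ?_
      rw [← sub_smul, inner_smul_left, real_inner_comm (x - y) (u i), inner_sub_left]
      simp; ring
    have hnn : ∀ i, 0 ≤ c i * ((T ⟪x, u i⟫ - T ⟪y, u i⟫) * (⟪x, u i⟫ - ⟪y, u i⟫)) := by
      intro i
      apply mul_nonneg (hc i).le
      rcases le_total ⟪x, u i⟫ ⟪y, u i⟫ with h | h
      · exact mul_nonneg_of_nonpos_of_nonpos
          (sub_nonpos.2 (hmono.monotoneOn (hx i) (hy i) h)) (sub_nonpos.2 h)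
      · exact mul_nonneg
          (sub_nonneg.2 (hmono.monotoneOn (hy i) (hx i) h)) (sub_nonneg.2 h)
    rw [h1] at h0
    have h2 := (Finset.sum_eq_zero_iff_of_nonneg (fun i _ => hnn i)).1 h0
    have h3 : ∀ i, ⟪u i, x - y⟫ = 0 := by
      intro i
      have := h2 i (Finset.mem_univ i)
      rw [mul_eq_zero, mul_eq_zero] at this
      rw [real_inner_comm, inner_sub_left]
      rcases this with h | h | h
      · exact absurd h (hc i).ne'
      · have := hmono.injOn (hx i) (hy i) (sub_eq_zero.1 h)
        rw [this, sub_self]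
      · exact h
    have h4 := hiso (x - y)
    simp only [h3] at h4
    simp at h4
    exact hne (sub_eq_zero.1 (by simpa using h4.symm))
  calc ∫⁻ x in slab u I, ENNReal.ofReal ((∏ i, f ⟪x, u i⟫ ^ c i) * (1 + G x))
      ≤ ∫⁻ x in slab u I, ENNReal.ofReal |(frameOp u c (fun i => T' ⟪x, u i⟫)).det| * H (Θ x) := by
        apply setLIntegral_mono' (isOpen_slab u hI).measurableSet
        intro x hx
        refine le_trans ?_ (mul_le_mul_right (hH x hx) _)
        rw [← ENNReal.ofReal_mul (abs_nonneg _)]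
        apply ENNReal.ofReal_le_ofReal
        have e1 : ∏ i, f ⟪x, u i⟫ ^ c i =
            (∏ i, h (T ⟪x, u i⟫) ^ c i) * ∏ i, T' ⟪x, u i⟫ ^ c i := by
          rw [← Finset.prod_mul_distrib]
          refine Finset.prod_congr rfl fun i _ => ?_
          rw [hf _ (hx i), Real.mul_rpow (hh _) (hT' _ (hx i)).le]
        rw [e1, mul_assoc, mul_comm |_|]
        apply mul_le_mul_of_nonneg_left _ (Finset.prod_nonneg fun i _ => Real.rpow_nonneg (hh _) _)
        exact (hG x hx).trans (le_abs_self _)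
    _ = ∫⁻ x in Θ '' slab u I, H x :=
        (lintegral_image_eq_lintegral_abs_det_fderiv_mul volume
          (isOpen_slab u hI).measurableSet hder hinj H).symm
    _ ≤ _ := setLIntegral_le_lintegral _ _

lemma barthe_quant [FiniteDimensional ℝ E] [MeasurableSpace E] [BorelSpace E]
    {u : ι → E} {c : ι → ℝ} (hu : ∀ i, ‖u i‖ = 1) (hc : ∀ i, 0 < c i)
    (hiso : ∀ x : E, ∑ i, c i * ⟪u i, x⟫ ^ 2 = ‖x‖ ^ 2) {D : ℕ} (hD : ∑ i, c i = D)
    {I : Set ℝ} (hI : IsOpen I) {T T' f h : ℝ → ℝ}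
    (hT : ∀ t ∈ I, HasDerivAt T (T' t) t) (hT' : ∀ t ∈ I, 0 < T' t) (hmono : StrictMonoOn T I)
    (hh : ∀ y, 0 ≤ h y) (hf : ∀ t ∈ I, f t = h (T t) * T' t) (hfm : Measurable f)
    {H : E → ℝ≥0∞}
    (hH : ∀ x ∈ slab u I, ENNReal.ofReal (∏ i, h (T ⟪x, u i⟫) ^ c i) ≤
      H (∑ i, (c i * T ⟪x, u i⟫) • u i))
    {t₀ r M κ m : ℝ} {x₀ : E} (hx₀ : ∀ i, ⟪x₀, u i⟫ = t₀) (hr : 0 < r) (hm : 0 ≤ m) (hκ : 0 ≤ κ)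
    (hJI : ∀ t ∈ Icc (t₀ - r) (t₀ + r), t ∈ I)
    (hJM : ∀ t ∈ Icc (t₀ - r) (t₀ + r), T' t ≤ M)
    (hJm : ∀ t ∈ Icc (t₀ - r) (t₀ + r), m ≤ f t)
    (hJκ : ∀ t ∈ Icc (t₀ - r) (t₀ + r), ∀ t' ∈ Icc (t₀ - r) (t₀ + r),
      κ * |t - t'| ≤ |T' t - T' t'|)
    {a b : ι} {d η δ : ℝ} (hd : 0 ≤ d) (ha : d ≤ c a) (hb : d ≤ c b) (hη : 0 ≤ η)
    (hη' : η ≤ |⟪u a, u b⟫|) (hδ : 0 < δ) (hδ' : δ ≤ ‖u a - u b‖) :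
    ∃ x₁ : E, (∫⁻ x in slab u I, ENNReal.ofReal (∏ i, f ⟪x, u i⟫ ^ c i)) +
      ENNReal.ofReal (m ^ D * ((8 * M ^ 2)⁻¹ * d * η ^ 2 * (κ * (r / 4 * δ)) ^ 2)) *
        volume (ball x₁ (r / 4)) ≤ ∫⁻ x, H x := by
  classical
  set v := u a - u b with hv
  have hvn : 0 < ‖v‖ := lt_of_lt_of_le hδ hδ'
  have hab : a ≠ b := by
    rintro rfl; simp [hv] at hvn
  set x₁ := x₀ + (r / 2 / ‖v‖) • v with hx₁
  set K := (8 * M ^ 2)⁻¹ * d * η ^ 2 * (κ * (r / 4 * δ)) ^ 2 with hK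
  have hK0 : 0 ≤ K := by positivity
  set B := ball x₁ (r / 4) with hB
  have hwn : ‖(r / 2 / ‖v‖) • v‖ = r / 2 := by
    rw [norm_smul, Real.norm_of_nonneg (by positivity)]; field_simp
  have hBt : ∀ x ∈ B, ∀ i, ⟪x, u i⟫ ∈ Icc (t₀ - r) (t₀ + r) := by
    intro x hx i
    have h1 : ‖x - x₀‖ ≤ r := by
      have : x - x₀ = (x - x₁) + (r / 2 / ‖v‖) • v := by rw [hx₁]; abel
      rw [this]
      refine (norm_add_le _ _).trans ?_
      rw [hB, mem_ball_iff_norm] at hx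
      rw [hwn]; linarith
    have h2 := abs_real_inner_le_norm (x - x₀) (u i)
    rw [hu, mul_one, inner_sub_left, hx₀] at h2
    have h3 := abs_le.1 (h2.trans h1)
    constructor <;> linarith
  have hBs : B ⊆ slab u I := fun x hx i => hJI _ (hBt x hx i)
  have hBd : ∀ x ∈ B, r / 4 * δ ≤ |⟪x, u a⟫ - ⟪x, u b⟫| := by
    intro x hx
    have e1 : ⟪x, u a⟫ - ⟪x, u b⟫ = ⟪x - x₁, v⟫ + r / 2 * ‖v‖ := by
      have e2 : ⟪x₀, v⟫ = 0 := by rw [hv, inner_sub_right, hx₀, hx₀, sub_self]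
      rw [← inner_sub_right, ← hv, inner_sub_left, hx₁, inner_add_left, e2, inner_smul_left,
        real_inner_self_eq_norm_sq]
      simp; field_simp; ring
    have e3 := abs_le.1 (abs_real_inner_le_norm (x - x₁) v)
    rw [hB, mem_ball_iff_norm] at hx
    have e4 : ‖x - x₁‖ * ‖v‖ ≤ r / 4 * ‖v‖ := by gcongr
    refine le_trans ?_ (le_abs_self _)
    rw [e1]
    nlinarith
  have hcore := barthe_core hc hiso hI hT hT' hmono hh hf hH
    (G := B.indicator fun _ => K) (by
      intro x hx
      by_cases hxB : x ∈ B
      · rw [indicator_of_mem hxB]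
        set M' := M
        have h1 := frame_gain_pair hu hc hiso (t := fun i => T' ⟪x, u i⟫) (M := M)
          (fun i => hT' _ (hx i)) (fun i => hJM _ (hBt x hxB i)) hab hd ha hb
        refine le_trans ?_ h1
        apply mul_le_mul_of_nonneg_left _
          (Finset.prod_nonneg fun i _ => Real.rpow_nonneg (hT' _ (hx i)).le _)
        have h2 : (κ * (r / 4 * δ)) ^ 2 ≤ (T' ⟪x, u a⟫ - T' ⟪x, u b⟫) ^ 2 := by
          rw [← sq_abs (T' ⟪x, u a⟫ - T' ⟪x, u b⟫)]
          apply pow_le_pow_left₀ (by positivity)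
          refine le_trans ?_ (hJκ _ (hBt x hxB a) _ (hBt x hxB b))
          exact mul_le_mul_of_nonneg_left (hBd x hxB) hκ
        have h3 : η ^ 2 ≤ ⟪u a, u b⟫ ^ 2 := by
          rw [← sq_abs ⟪u a, u b⟫]
          exact pow_le_pow_left₀ hη hη' 2
        rw [hK]
        gcongr
      · rw [indicator_of_notMem hxB, add_zero, mul_one]
        -- plain Ball-Barthe
        obtain ⟨M', hM'⟩ : ∃ M', ∀ i, T' ⟪x, u i⟫ ≤ M' := by
          obtain ⟨M', hM'⟩ := (Set.finite_range fun i => T' ⟪x, u i⟫).bddAbove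
          exact ⟨M', fun i => hM' ⟨i, rfl⟩⟩
        have h1 := frame_gain_pair hu hc hiso (t := fun i => T' ⟪x, u i⟫) (M := M')
          (fun i => hT' _ (hx i)) hM' hab le_rfl (hc a).le (hc b).le
        simpa using h1)
  refine ⟨x₁, le_trans ?_ hcore⟩
  have hfn : ∀ x ∈ slab u I, ∀ i, 0 ≤ f ⟪x, u i⟫ := fun x hx i => by
    rw [hf _ (hx i)]; exact mul_nonneg (hh _) (hT' _ (hx i)).le
  have hmeas : Measurable fun x : E => ENNReal.ofReal (∏ i, f ⟪x, u i⟫ ^ c i) := by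
    apply ENNReal.measurable_ofReal.comp
    apply Finset.measurable_prod
    intro i _
    exact (hfm.comp (by fun_prop)).pow_const _
  have hBm : MeasurableSet B := measurableSet_ball
  calc _ = (∫⁻ x in slab u I, ENNReal.ofReal (∏ i, f ⟪x, u i⟫ ^ c i)) +
        ∫⁻ x in slab u I, B.indicator (fun _ => ENNReal.ofReal (m ^ D * K)) x := by
        congr 1
        rw [lintegral_indicator hBm, setLIntegral_const, Measure.restrict_apply hBm,
          inter_eq_left.2 hBs]
    _ = ∫⁻ x in slab u I, (ENNReal.ofReal (∏ i, f ⟪x, u i⟫ ^ c i) +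
          B.indicator (fun _ => ENNReal.ofReal (m ^ D * K)) x) :=
        (lintegral_add_left hmeas _).symm
    _ ≤ _ := by
        apply setLIntegral_mono' (isOpen_slab u hI).measurableSet
        intro x hx
        have hP : 0 ≤ ∏ i, f ⟪x, u i⟫ ^ c i :=
          Finset.prod_nonneg fun i _ => Real.rpow_nonneg (hfn x hx i) _
        by_cases hxB : x ∈ B
        · rw [indicator_of_mem hxB, indicator_of_mem hxB, ← ENNReal.ofReal_add hP (by positivity)]
          apply ENNReal.ofReal_le_ofReal
          rw [mul_add, mul_one]
          have : m ^ D ≤ ∏ i, f ⟪x, u i⟫ ^ c i := by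
            calc m ^ D = ∏ i, m ^ c i := by
                  rcases hm.eq_or_lt with h0 | h0
                  · subst h0
                    have : ∀ i, (0:ℝ) ^ c i = 0 := fun i => Real.zero_rpow (hc i).ne'
                    have hD0 : D ≠ 0 := by
                      rintro rfl
                      have h9 : c a ≤ ∑ i, c i :=
                        Finset.single_le_sum (fun i _ => (hc i).le) (Finset.mem_univ a)
                      have := hc a
                      rw [hD] at h9; simp at h9; linarith
                    rw [zero_pow hD0, Finset.prod_eq_zero (Finset.mem_univ a) (this a)]
                  · rw [← Real.rpow_sum_of_pos h0, hD, Real.rpow_natCast]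
              _ ≤ _ := by
                  apply Finset.prod_le_prod
                  · intro i _; positivity
                  · intro i _
                    exact Real.rpow_le_rpow hm (hJm _ (hBt x hxB i)) (hc i).le
          have := mul_le_mul_of_nonneg_right this hK0
          linarith
        · rw [indicator_of_notMem hxB, indicator_of_notMem hxB]; simp

end frame

section transport

/-- unnormalized Gaussian -/
def gam (x : ℝ) : ℝ := Real.exp (-x ^ 2 / 2)

/-- total mass of the unnormalized Gaussian -/
def WW : ℝ := √(2 * Real.pi)

/-- normal distribution function -/
def NN (y : ℝ) : ℝ := 1 / 2 + (∫ x in (0:ℝ)..y, gam x) / WW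

lemma gam_pos (x : ℝ) : 0 < gam x := Real.exp_pos _

lemma gam_neg (x : ℝ) : gam (-x) = gam x := by simp [gam]

lemma gam_cont : Continuous gam := by unfold gam; fun_prop

lemma gam_le_one (x : ℝ) : gam x ≤ 1 := by
  unfold gam; rw [Real.exp_le_one_iff]; nlinarith [sq_nonneg x]

lemma gam_lower (x : ℝ) : 1 - x ^ 2 / 2 ≤ gam x := by
  have := Real.add_one_le_exp (-x ^ 2 / 2)
  unfold gam; linarith

lemma gam_le_gam {x y : ℝ} (h : |x| ≤ |y|) : gam y ≤ gam x := by
  unfold gam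
  apply Real.exp_le_exp.2
  have := sq_le_sq.2 h
  linarith

lemma WW_pos : 0 < WW := Real.sqrt_pos.2 (by positivity)

lemma WW_lower : 2.5 ≤ WW := by
  unfold WW
  apply Real.le_sqrt_of_sq_le
  nlinarith [Real.pi_gt_d2]

lemma WW_upper : WW ≤ 2.6 := by
  unfold WW
  rw [Real.sqrt_le_left (by norm_num)]
  nlinarith [Real.pi_lt_d2]

lemma gam_eq (x : ℝ) : gam x = Real.exp (-(1/2) * x ^ 2) := by
  unfold gam; congr 1; ring

lemma gam_integrable : Integrable gam := by
  have : gam = fun x => Real.exp (-(1/2) * x ^ 2) := funext gam_eq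
  rw [this]; exact integrable_exp_neg_mul_sq (by norm_num)

lemma gam_integral_Ioi : ∫ x in Ioi (0:ℝ), gam x = WW / 2 := by
  simp_rw [gam_eq]
  rw [integral_gaussian_Ioi, WW]
  congr 2; ring

lemma NN_hasDerivAt (y : ℝ) : HasDerivAt NN (gam y / WW) y := by
  unfold NN
  have := intervalIntegral.integral_hasDerivAt_right (gam_cont.intervalIntegrable 0 y)
    gam_cont.aestronglyMeasurable.stronglyMeasurableAtFilter gam_cont.continuousAt
  exact (this.div_const WW).const_add _

lemma NN_cont : Continuous NN :=
  continuous_iff_continuousAt.2 fun y => (NN_hasDerivAt y).continuousAt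

lemma NN_strictMono : StrictMono NN := by
  apply strictMono_of_deriv_pos
  intro y
  rw [(NN_hasDerivAt y).deriv]
  exact div_pos (gam_pos y) WW_pos

lemma NN_zero : NN 0 = 1 / 2 := by simp [NN]

lemma NN_neg (y : ℝ) : NN (-y) = 1 - NN y := by
  have : ∫ x in (0:ℝ)..(-y), gam x = - ∫ x in (0:ℝ)..y, gam x := by
    have h1 := intervalIntegral.integral_comp_neg (a := 0) (b := y) gam
    simp only [gam_neg, neg_zero] at h1
    rw [h1, intervalIntegral.integral_symm]
  unfold NN
  rw [this]; ring

lemma NN_tendsto : Filter.Tendsto NN Filter.atTop (nhds 1) := by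
  have h1 := intervalIntegral_tendsto_integral_Ioi (0:ℝ) gam_integrable.integrableOn
    Filter.tendsto_id
  rw [gam_integral_Ioi] at h1
  have h2 := (h1.div_const WW).const_add (1/2)
  have : 1 / 2 + WW / 2 / WW = 1 := by have := WW_pos.ne'; field_simp; norm_num
  rw [this] at h2
  exact h2

lemma NN_lt_one (y : ℝ) : NN y < 1 := by
  have h1 : NN y < NN (y + 1) := NN_strictMono (by linarith)
  exact lt_of_lt_of_le h1 (NN_strictMono.monotone.ge_of_tendsto NN_tendsto _)

lemma NN_pos (y : ℝ) : 0 < NN y := by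
  have := NN_lt_one (-y)
  rw [NN_neg] at this; linarith

lemma NN_sub (x y : ℝ) : NN y - NN x = (∫ z in x..y, gam z) / WW := by
  unfold NN
  rw [← intervalIntegral.integral_interval_sub_left (gam_cont.intervalIntegrable 0 y)
    (gam_cont.intervalIntegrable 0 x)]
  ring

lemma NN_sub_le {x y : ℝ} (h : x ≤ y) : NN y - NN x ≤ (y - x) / WW := by
  rw [NN_sub]
  apply div_le_div_of_nonneg_right _ WW_pos.le
  have := intervalIntegral.integral_mono_on (μ := volume) h (gam_cont.intervalIntegrable x y)
    (g := fun _ => (1:ℝ)) (continuous_const.intervalIntegrable _ _) (fun z _ => gam_le_one z)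
  simpa using this

lemma NN_sub_ge {x y m : ℝ} (h : x ≤ y) (hm : ∀ z ∈ Icc x y, m ≤ gam z) :
    (y - x) * m / WW ≤ NN y - NN x := by
  rw [NN_sub]
  apply div_le_div_of_nonneg_right _ WW_pos.le
  have := intervalIntegral.integral_mono_on (μ := volume) h (f := fun _ => m) (continuous_const.intervalIntegrable _ _)
    (gam_cont.intervalIntegrable x y) hm
  simpa using this

lemma NN_tail {y : ℝ} (hy : 0 ≤ y) : 2 * (1 - NN y) ≤ gam y := by
  have h1 : ∀ R, y ≤ R → NN R ≤ NN y + gam y / 2 := by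
    intro R hR
    have e1 : NN R - NN y ≤ gam y * (NN (R - y) - NN 0) := by
      rw [NN_sub, NN_sub, ← mul_div_assoc]
      apply div_le_div_of_nonneg_right _ WW_pos.le
      have e2 : ∫ z in y..R, gam z = ∫ z in (0:ℝ)..(R - y), gam (z + y) := by
        rw [intervalIntegral.integral_comp_add_right]; simp
      rw [e2, ← intervalIntegral.integral_const_mul]
      apply intervalIntegral.integral_mono_on (by linarith)
      · exact (gam_cont.comp (by fun_prop)).intervalIntegrable _ _
      · exact (continuous_const.mul gam_cont).intervalIntegrable _ _
      · intro z hz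
        unfold gam
        rw [← Real.exp_add]
        apply Real.exp_le_exp.2
        nlinarith [mul_nonneg hz.1 hy]
    have e3 := NN_lt_one (R - y)
    rw [NN_zero] at e1
    have := gam_pos y
    nlinarith
  have h2 : (1:ℝ) ≤ NN y + gam y / 2 :=
    le_of_tendsto NN_tendsto (Filter.eventually_atTop.2 ⟨y, h1⟩)
  linarith

lemma NN_tail' {y : ℝ} (hy : y ≤ 0) : 2 * NN y ≤ gam y := by
  have := NN_tail (neg_nonneg.2 hy)
  rw [NN_neg, gam_neg] at this
  linarith

lemma NN_surj {p : ℝ} (hp : p ∈ Ioo (0:ℝ) 1) : ∃ y, NN y = p := by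
  have h1 : ∃ y, p ≤ NN y := by
    obtain ⟨y, hy⟩ := ((tendsto_order.1 NN_tendsto).1 p hp.2).exists
    exact ⟨y, hy.le⟩
  have h2 : ∃ y, NN y ≤ p := by
    obtain ⟨y, hy⟩ := ((tendsto_order.1 NN_tendsto).1 (1 - p) (by linarith [hp.1])).exists
    exact ⟨-y, by rw [NN_neg]; linarith⟩
  exact mem_range_of_exists_le_of_exists_ge NN_cont h2 h1

/-- quantile function -/
def QQ : ℝ → ℝ := Function.invFun NN

lemma NN_QQ {p : ℝ} (hp : p ∈ Ioo (0:ℝ) 1) : NN (QQ p) = p :=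
  Function.invFun_eq (NN_surj hp)

lemma QQ_strictMonoOn : StrictMonoOn QQ (Ioo 0 1) := by
  intro p hp q hq hpq
  rw [← NN_strictMono.lt_iff_lt, NN_QQ hp, NN_QQ hq]
  exact hpq

lemma QQ_NN (y : ℝ) : QQ (NN y) = y := Function.leftInverse_invFun NN_strictMono.injective y

lemma QQ_hasDerivAt {p : ℝ} (hp : p ∈ Ioo (0:ℝ) 1) : HasDerivAt QQ (gam (QQ p) / WW)⁻¹ p := by
  have hnhds : Ioo (0:ℝ) 1 ∈ nhds p := isOpen_Ioo.mem_nhds hp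
  apply HasDerivAt.of_local_left_inverse (f := NN)
  · apply QQ_strictMonoOn.continuousAt_of_image_mem_nhds hnhds
    have : QQ '' Ioo 0 1 = univ := by
      ext y
      simp only [mem_image, mem_univ, iff_true]
      exact ⟨NN y, ⟨NN_pos y, NN_lt_one y⟩, QQ_NN y⟩
    rw [this]; exact Filter.univ_mem
  · exact NN_hasDerivAt _
  · exact (div_pos (gam_pos _) WW_pos).ne'
  · filter_upwards [hnhds] with q hq using NN_QQ hq

lemma gam_ratio {x y : ℝ} : gam x = gam y * Real.exp ((y ^ 2 - x ^ 2) / 2) := by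
  unfold gam; rw [← Real.exp_add]; congr 1; ring

variable {s : ℝ}

lemma truncGaussU_of_nonneg {t : ℝ} (ht : 0 ≤ t) : truncGaussU s t = gam (t - s) := by
  simp [truncGaussU, gam, ht]

lemma truncGaussU_nonneg (t : ℝ) : 0 ≤ truncGaussU s t := by
  unfold truncGaussU; split_ifs
  · positivity
  · exact le_rfl

lemma truncGaussU_measurable : Measurable (truncGaussU s) := by
  unfold truncGaussU
  apply Measurable.ite measurableSet_Ici (by fun_prop) measurable_const

lemma integral_truncGaussU : ∫ t, truncGaussU s t = WW * NN s := by
  have h0 : truncGaussU s = (Ici (0:ℝ)).indicator (fun t => gam (t - s)) := by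
    ext t
    by_cases ht : 0 ≤ t
    · rw [indicator_of_mem (by exact ht), truncGaussU_of_nonneg ht]
    · rw [indicator_of_notMem (by exact ht)]; simp [truncGaussU, ht]
  rw [h0, integral_indicator measurableSet_Ici, integral_Ici_eq_integral_Ioi]
  have h1 := intervalIntegral_tendsto_integral_Ioi (0:ℝ)
    (gam_integrable.comp_sub_right s).integrableOn Filter.tendsto_id
  have h2 : Filter.Tendsto (fun R : ℝ => ∫ t in (0:ℝ)..(id R), gam (t - s)) Filter.atTop
      (nhds (WW * (1 - NN (-s)))) := by
    have e1 : ∀ R : ℝ, ∫ t in (0:ℝ)..(id R), gam (t - s) = WW * (NN (R - s) - NN (-s)) := by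
      intro R
      rw [intervalIntegral.integral_comp_sub_right, NN_sub, zero_sub, mul_div_cancel₀]
      · rfl
      · exact WW_pos.ne'
    simp_rw [e1]
    apply Filter.Tendsto.const_mul
    apply Filter.Tendsto.sub_const
    exact NN_tendsto.comp (Filter.tendsto_atTop_add_const_right _ (-s) Filter.tendsto_id)
  rw [tendsto_nhds_unique h1 h2, NN_neg]; ring

lemma NN_half (hs : 0 ≤ s) : 1 / 2 ≤ NN s := by
  rw [← NN_zero]; exact NN_strictMono.monotone hs

/-- forward transport -/
def TT (s t : ℝ) : ℝ := QQ ((NN (t - s) - NN (-s)) / NN s)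
def TT' (s t : ℝ) : ℝ := gam (t - s) / (gam (TT s t) * NN s)

lemma TT_mem {t : ℝ} (ht : 0 < t) : (NN (t - s) - NN (-s)) / NN s ∈ Ioo (0:ℝ) 1 := by
  have h1 : NN (-s) < NN (t - s) := NN_strictMono (by linarith)
  have h2 := NN_pos s
  have h3 := NN_lt_one (t - s)
  constructor
  · apply div_pos <;> linarith
  · rw [div_lt_one h2, NN_neg]; linarith

lemma NN_TT {t : ℝ} (ht : 0 < t) : NN (TT s t) = (NN (t - s) - NN (-s)) / NN s := NN_QQ (TT_mem ht)

lemma TT_hasDerivAt {t : ℝ} (ht : 0 < t) : HasDerivAt (TT s) (TT' s t) t := by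
  have h1 : HasDerivAt (fun t => (NN (t - s) - NN (-s)) / NN s) (gam (t - s) / WW / NN s) t := by
    have := (NN_hasDerivAt (t - s)).comp_sub_const t s
    exact (this.sub_const _).div_const _
  have h2 := (QQ_hasDerivAt (TT_mem (s := s) ht)).comp t h1
  refine h2.congr_deriv ?_
  unfold TT' TT
  have := WW_pos.ne'; have := (NN_pos s).ne'
  have := (gam_pos (QQ ((NN (t - s) - NN (-s)) / NN s))).ne'
  field_simp

lemma TT'_pos (t : ℝ) : 0 < TT' s t :=
  div_pos (gam_pos _) (mul_pos (gam_pos _) (NN_pos _))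

lemma TT_strictMonoOn : StrictMonoOn (TT s) (Ioi 0) := by
  intro x hx y hy hxy
  apply QQ_strictMonoOn (TT_mem hx) (TT_mem hy)
  apply div_lt_div_of_pos_right _ (NN_pos s)
  have := NN_strictMono (show x - s < y - s by linarith)
  linarith

/-- backward transport -/
def SS (s y : ℝ) : ℝ := s + QQ (NN (-s) + NN s * NN y)
def SS' (s y : ℝ) : ℝ := NN s * gam y / gam (SS s y - s)

lemma SS_mem (y : ℝ) : NN (-s) + NN s * NN y ∈ Ioo (0:ℝ) 1 := by
  have h1 := NN_pos s; have h2 := NN_pos y; have h3 := NN_lt_one y; have h4 := NN_pos (-s)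
  constructor
  · positivity
  · rw [NN_neg]; nlinarith

lemma NN_SS (y : ℝ) : NN (SS s y - s) = NN (-s) + NN s * NN y := by
  unfold SS; rw [add_sub_cancel_left, NN_QQ (SS_mem y)]

lemma SS_pos (y : ℝ) : 0 < SS s y := by
  have : NN (-s) < NN (SS s y - s) := by
    rw [NN_SS]; have := mul_pos (NN_pos s) (NN_pos y); linarith
  have := NN_strictMono.lt_iff_lt.1 this
  linarith

lemma SS_hasDerivAt (y : ℝ) : HasDerivAt (SS s) (SS' s y) y := by
  have h1 : HasDerivAt (fun y => NN (-s) + NN s * NN y) (NN s * (gam y / WW)) y :=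
    ((NN_hasDerivAt y).const_mul _).const_add _
  have h2 := ((QQ_hasDerivAt (SS_mem (s := s) y)).comp y h1).const_add s
  refine h2.congr_deriv ?_
  unfold SS' SS
  rw [add_sub_cancel_left]
  have := WW_pos.ne'
  have := (gam_pos (QQ (NN (-s) + NN s * NN y))).ne'
  field_simp

lemma SS'_pos (y : ℝ) : 0 < SS' s y :=
  div_pos (mul_pos (NN_pos _) (gam_pos _)) (gam_pos _)

lemma SS_strictMono : StrictMono (SS s) := by
  intro x y hxy
  have := QQ_strictMonoOn (SS_mem (s := s) x) (SS_mem (s := s) y)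
    (by have := mul_lt_mul_of_pos_left (NN_strictMono hxy) (NN_pos s); linarith)
  unfold SS; linarith

/-! Estimates -/

lemma gam_growth {a b : ℝ} (h : a ^ 2 + 0.2 * (b - a) ≤ b ^ 2) :
    gam b * (1 + 0.1 * (b - a)) ≤ gam a := by
  rw [gam_ratio (x := a) (y := b)]
  apply mul_le_mul_of_nonneg_left _ (gam_pos b).le
  have := Real.add_one_le_exp ((b ^ 2 - a ^ 2) / 2)
  linarith


lemma TT_neg (hs : s ∈ Icc (0 : ℝ) 0.15) {t : ℝ} (ht : t ∈ Icc (s + 0.15 - 1/20) (s + 0.15 + 1/20)) : TT s t < 0 := by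
  have ht0 : 0 < t := by linarith [ht.1, hs.1]
  rw [← NN_strictMono.lt_iff_lt, NN_TT ht0, NN_zero, div_lt_iff₀ (NN_pos s)]
  have h1 := NN_sub_le (show -s ≤ t - s by linarith)
  have h2 := NN_half hs.1
  have h3 : (t - s - -s) / WW ≤ 0.35 / 2.5 := by
    apply div_le_div₀ (by norm_num) (by linarith [ht.2, hs.2]) (by norm_num) WW_lower
  have : (0.35:ℝ) / 2.5 < 1/4 := by norm_num
  linarith

lemma TT'_upper (hs : s ∈ Icc (0 : ℝ) 0.15) {t : ℝ} (ht : t ∈ Icc (s + 0.15 - 1/20) (s + 0.15 + 1/20)) : TT' s t ≤ 16 := by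
  have ht0 : 0 < t := by linarith [ht.1, hs.1]
  have h1 := NN_tail' (TT_neg hs ht).le
  rw [NN_TT ht0] at h1
  have h2 := NN_pos s
  have h3 := NN_sub_ge (x := 0) (y := t - s) (m := gam (t - s)) (by linarith [ht.1])
    (fun z hz => gam_le_gam (by rw [abs_of_nonneg hz.1, abs_of_nonneg (hz.1.trans hz.2)]; exact hz.2))
  have h4 : NN (-s) ≤ NN 0 := NN_strictMono.monotone (by linarith [hs.1])
  have h5 : 2 * (NN (t - s) - NN (-s)) ≤ gam (TT s t) * NN s := by
    rw [← mul_div_assoc, div_le_iff₀ h2] at h1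
    exact h1
  have h6 := gam_pos (t - s)
  have h7 : gam (t - s) / 32 ≤ (t - s - 0) * gam (t - s) / WW := by
    rw [div_le_div_iff₀ (by norm_num) WW_pos]
    have := WW_upper
    have : WW ≤ 32 * (t - s) := by linarith [ht.1]
    nlinarith
  unfold TT'
  rw [div_le_iff₀ (mul_pos (gam_pos _) h2)]
  linarith

lemma TT'_var_aux (hs : s ∈ Icc (0 : ℝ) 0.15) {t t' : ℝ} (ht : t ∈ Icc (s + 0.15 - 1/20) (s + 0.15 + 1/20))
    (ht' : t' ∈ Icc (s + 0.15 - 1/20) (s + 0.15 + 1/20)) (h : t ≤ t') :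
    1/25 * (t' - t) ≤ TT' s t - TT' s t' := by
  have ht0 : 0 < t := by linarith [ht.1, hs.1]
  have ht0' : 0 < t' := by linarith [ht'.1, hs.1]
  have h1 : gam (t' - s) * (1 + 0.1 * (t' - t)) ≤ gam (t - s) := by
    have := gam_growth (a := t - s) (b := t' - s) (by
      have := ht.1; have := ht'.1
      nlinarith)
    convert this using 3; ring
  have h2 : gam (TT s t) ≤ gam (TT s t') := by
    apply gam_le_gam
    rw [abs_of_neg (TT_neg hs ht), abs_of_neg (TT_neg hs ht')]
    have := (TT_strictMonoOn (s := s)).monotoneOn ht0 ht0' h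
    linarith
  have h3 : TT' s t' * (1 + 0.1 * (t' - t)) ≤ TT' s t := by
    unfold TT'
    rw [div_mul_eq_mul_div]
    apply div_le_div₀ (gam_pos _).le h1 (mul_pos (gam_pos _) (NN_pos s))
    exact mul_le_mul_of_nonneg_right h2 (NN_pos s).le
  have h4 : 0.9 ≤ TT' s t' := by
    unfold TT'
    rw [le_div_iff₀ (mul_pos (gam_pos _) (NN_pos s))]
    have e1 := gam_lower (t' - s)
    have e2 : gam (TT s t') * NN s ≤ 1 * 1 :=
      mul_le_mul (gam_le_one _) (NN_lt_one s).le (NN_pos s).le zero_le_one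
    have e3 : (t' - s) ^ 2 ≤ 0.2 ^ 2 := by
      apply pow_le_pow_left₀ (by linarith [ht'.1]) (by linarith [ht'.2])
    linarith
  nlinarith

lemma TT'_var (hs : s ∈ Icc (0 : ℝ) 0.15) {t t' : ℝ} (ht : t ∈ Icc (s + 0.15 - 1/20) (s + 0.15 + 1/20))
    (ht' : t' ∈ Icc (s + 0.15 - 1/20) (s + 0.15 + 1/20)) :
    1/25 * |t - t'| ≤ |TT' s t - TT' s t'| := by
  rcases le_total t t' with h | h
  · have := TT'_var_aux hs ht ht' h
    rw [abs_of_nonpos (sub_nonpos.2 h)]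
    refine le_trans ?_ (le_abs_self _); linarith
  · have := TT'_var_aux hs ht' ht h
    rw [abs_of_nonneg (sub_nonneg.2 h), abs_sub_comm (TT' s t)]
    exact this.trans (le_abs_self _)

lemma p_lower (hs : s ∈ Icc (0 : ℝ) 0.15) {t : ℝ} (ht : t ∈ Icc (s + 0.15 - 1/20) (s + 0.15 + 1/20)) :
    1/4 ≤ truncGaussU s t / (WW * NN s) := by
  have ht0 : 0 < t := by linarith [ht.1, hs.1]
  rw [truncGaussU_of_nonneg ht0.le, le_div_iff₀ (mul_pos WW_pos (NN_pos s))]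
  have e1 := gam_lower (t - s)
  have e3 : (t - s) ^ 2 ≤ 0.2 ^ 2 := by
    apply pow_le_pow_left₀ (by linarith [ht.1]) (by linarith [ht.2])
  have e2 : WW * NN s ≤ 2.6 * 1 :=
      mul_le_mul WW_upper (NN_lt_one s).le (NN_pos s).le (by norm_num)
  linarith

lemma SS_gt (hs : s ∈ Icc (0 : ℝ) 0.15) {y : ℝ} (hy : y ∈ Icc (-0.15 - 1/20 : ℝ) (-0.15 + 1/20)) : 0 < SS s y - s := by
  rw [← NN_strictMono.lt_iff_lt, NN_SS, NN_zero]
  have h1 := NN_sub_le (x := 0) (y := s) hs.1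
  have h2 := NN_sub_le (x := y) (y := 0) (by linarith [hy.2])
  have h3 : (s - 0) / WW ≤ 0.15 / 2.5 := by
    apply div_le_div₀ (by norm_num) (by linarith [hs.2]) (by norm_num) WW_lower
  have h4 : (0 - y) / WW ≤ 0.2 / 2.5 := by
    apply div_le_div₀ (by norm_num) (by linarith [hy.1]) (by norm_num) WW_lower
  rw [NN_zero] at h1 h2
  rw [NN_neg]
  have e1 : (0.15:ℝ) / 2.5 = 0.06 := by norm_num
  have e2 : (0.2:ℝ) / 2.5 = 0.08 := by norm_num
  rw [e1] at h3
  rw [e2] at h4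
  have h5 : NN s ≤ 0.6 := by linarith
  have h6 : 0.4 ≤ NN y := by linarith
  have := NN_half hs.1
  nlinarith

lemma SS'_upper (hs : s ∈ Icc (0 : ℝ) 0.15) {y : ℝ} (hy : y ∈ Icc (-0.15 - 1/20 : ℝ) (-0.15 + 1/20)) : SS' s y ≤ 16 := by
  have h1 := NN_tail (SS_gt hs hy).le
  rw [NN_SS, NN_neg] at h1
  have h2 : NN y ≤ 1/2 := by
    rw [← NN_zero]; exact NN_strictMono.monotone (by linarith [hy.2])
  unfold SS'
  rw [div_le_iff₀ (gam_pos _)]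
  have h3 := NN_pos s
  have h4 : NN s * gam y ≤ NN s * 1 := mul_le_mul_of_nonneg_left (gam_le_one y) h3.le
  nlinarith

lemma SS'_var_aux (hs : s ∈ Icc (0 : ℝ) 0.15) {t t' : ℝ} (ht : t ∈ Icc (-0.15 - 1/20 : ℝ) (-0.15 + 1/20))
    (ht' : t' ∈ Icc (-0.15 - 1/20 : ℝ) (-0.15 + 1/20)) (h : t ≤ t') :
    1/25 * (t' - t) ≤ SS' s t' - SS' s t := by
  have h1 : gam t * (1 + 0.1 * (t' - t)) ≤ gam t' := by
    have := gam_growth (a := -t') (b := -t) (by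
      have := ht.2; have := ht'.2
      nlinarith)
    rw [gam_neg, gam_neg] at this
    convert this using 3; ring
  have h2 : gam (SS s t' - s) ≤ gam (SS s t - s) := by
    apply gam_le_gam
    rw [abs_of_pos (SS_gt hs ht), abs_of_pos (SS_gt hs ht')]
    have := SS_strictMono.monotone (f := SS s) h
    linarith
  have h3 : SS' s t * (1 + 0.1 * (t' - t)) ≤ SS' s t' := by
    unfold SS'
    rw [div_mul_eq_mul_div, mul_assoc]
    apply div_le_div₀ (mul_pos (NN_pos s) (gam_pos _)).le _ (gam_pos _) h2
    exact mul_le_mul_of_nonneg_left h1 (NN_pos s).le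
  have h4 : 0.45 ≤ SS' s t := by
    unfold SS'
    rw [le_div_iff₀ (gam_pos _)]
    have e1 := gam_lower t
    have e2 := gam_le_one (SS s t - s)
    have e3 : (-t) ^ 2 ≤ 0.2 ^ 2 := by
      apply pow_le_pow_left₀ (by linarith [ht.2]) (by linarith [ht.1])
    have e4 := NN_half hs.1
    nlinarith
  nlinarith

lemma SS'_var (hs : s ∈ Icc (0 : ℝ) 0.15) {t t' : ℝ} (ht : t ∈ Icc (-0.15 - 1/20 : ℝ) (-0.15 + 1/20))
    (ht' : t' ∈ Icc (-0.15 - 1/20 : ℝ) (-0.15 + 1/20)) :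
    1/25 * |t - t'| ≤ |SS' s t - SS' s t'| := by
  rcases le_total t t' with h | h
  · have := SS'_var_aux hs ht ht' h
    rw [abs_of_nonpos (sub_nonpos.2 h), abs_sub_comm (SS' s t)]
    refine le_trans ?_ (le_abs_self _); linarith
  · have := SS'_var_aux hs ht' ht h
    rw [abs_of_nonneg (sub_nonneg.2 h)]
    exact this.trans (le_abs_self _)

lemma q_lower {y : ℝ} (hy : y ∈ Icc (-0.15 - 1/20 : ℝ) (-0.15 + 1/20)) :
    1/4 ≤ gam y / WW := by
  rw [le_div_iff₀ WW_pos]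
  have e1 := gam_lower y
  have e3 : (-y) ^ 2 ≤ 0.2 ^ 2 := by
      apply pow_le_pow_left₀ (by linarith [hy.2]) (by linarith [hy.1])
  have := WW_upper
  linarith

end transport

section geometry

variable {E : Type*} [NormedAddCommGroup E] [InnerProductSpace ℝ E] [FiniteDimensional ℝ E]

lemma select_frame {ι : Type*} [Fintype ι] {u : ι → E} {c : ι → ℝ} (hu : ∀ i, ‖u i‖ = 1)
    (hc : ∀ i, 0 < c i) (hiso : ∀ x : E, ∑ i, c i * ⟪u i, x⟫ ^ 2 = ‖x‖ ^ 2) {D : ℕ}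
    (hD : Module.finrank ℝ E = D) (m : ℕ) (hm : m ≤ D) :
    ∃ idx : Fin m → ι, (∀ j, ((Fintype.card ι : ℕ) : ℝ)⁻¹ ≤ c (idx j)) ∧
      ∀ j j', j ≠ j' → ((Fintype.card ι : ℕ) : ℝ)⁻¹ ≤ ‖u (idx j) - u (idx j')‖ ^ 2 := by
  induction m with
  | zero => exact ⟨Fin.elim0, fun j => j.elim0, fun j => j.elim0⟩
  | succ m ih =>
    obtain ⟨idx, h1, h2⟩ := ih (by omega)
    set K : Submodule ℝ E := Submodule.span ℝ (Set.range (u ∘ idx)) with hK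
    have hKr : Module.finrank ℝ K ≤ m := by
      have := finrank_range_le_card (R := ℝ) (u ∘ idx)
      simpa [Set.finrank] using this
    have hKt : Kᗮ ≠ ⊥ := by
      intro h
      have := Submodule.finrank_add_finrank_orthogonal K
      rw [h, finrank_bot, hD] at this
      omega
    obtain ⟨y, hy, hy0⟩ := Submodule.exists_mem_ne_zero_of_ne_bot hKt
    have hyn : 0 < ‖y‖ := norm_pos_iff.2 hy0
    set v := ‖y‖⁻¹ • y with hv
    have hvn : ‖v‖ = 1 := by
      rw [hv, norm_smul, norm_inv, norm_norm]; field_simp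
    have hvo : ∀ j, ⟪u (idx j), v⟫ = 0 := fun j => by
      have h0 : ⟪u (idx j), y⟫ = 0 := (Submodule.mem_orthogonal K y).1 hy (u (idx j))
        (Submodule.subset_span ⟨j, rfl⟩)
      rw [hv, inner_smul_right, h0, mul_zero]
    have hsum := hiso v
    rw [hvn] at hsum
    obtain ⟨i, hi⟩ : ∃ i, ((Fintype.card ι : ℕ) : ℝ)⁻¹ ≤ c i * ⟪u i, v⟫ ^ 2 := by
      by_contra! hlt
      have hne : Nonempty ι := by
        by_contra hne
        rw [not_nonempty_iff] at hne
        simp at hsum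
      have : ∑ i, c i * ⟪u i, v⟫ ^ 2 < ∑ _i : ι, ((Fintype.card ι : ℕ) : ℝ)⁻¹ :=
        Finset.sum_lt_sum_of_nonempty Finset.univ_nonempty fun i _ => hlt i
      rw [hsum] at this
      simp at this
    have hle : ⟪u i, v⟫ ^ 2 ≤ 1 := by
      have := abs_real_inner_le_norm (u i) v
      rw [hu, hvn, mul_one] at this
      rw [← sq_abs]; exact pow_le_one₀ (abs_nonneg _) this
    have hcle : c i ≤ 1 := by
      have e1 := hiso (u i)
      have e2 : c i * ⟪u i, u i⟫ ^ 2 ≤ ∑ j, c j * ⟪u j, u i⟫ ^ 2 :=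
        Finset.single_le_sum (f := fun j => c j * ⟪u j, u i⟫ ^ 2)
          (fun j _ => mul_nonneg (hc j).le (sq_nonneg _)) (Finset.mem_univ i)
      rw [e1, real_inner_self_eq_norm_sq, hu] at e2
      simpa using e2
    have hci : ((Fintype.card ι : ℕ) : ℝ)⁻¹ ≤ c i := by
      have := hc i; nlinarith
    have hvi : ((Fintype.card ι : ℕ) : ℝ)⁻¹ ≤ ⟪u i, v⟫ ^ 2 := by
      have := hc i; nlinarith [sq_nonneg ⟪u i, v⟫]
    have hdist : ∀ j, ((Fintype.card ι : ℕ) : ℝ)⁻¹ ≤ ‖u (idx j) - u i‖ ^ 2 := fun j => by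
      refine hvi.trans ?_
      have := abs_real_inner_le_norm (u (idx j) - u i) v
      rw [inner_sub_left, hvo, hvn, mul_one, zero_sub, abs_neg] at this
      rw [← sq_abs]; exact pow_le_pow_left₀ (abs_nonneg _) this 2
    refine ⟨Fin.snoc idx i, ?_, ?_⟩
    · intro j
      refine Fin.lastCases ?_ (fun j => ?_) j
      · simpa using hci
      · simpa using h1 j
    · intro j j'
      refine Fin.lastCases ?_ (fun j => ?_) j
      · refine Fin.lastCases ?_ (fun j' => ?_) j'
        · intro h; exact absurd rfl h
        · intro _; rw [norm_sub_rev]; simpa using hdist j'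
      · refine Fin.lastCases ?_ (fun j' => ?_) j'
        · intro _; simpa using hdist j
        · intro h
          have : j ≠ j' := fun h' => h (by rw [h'])
          simpa using h2 j j' this

lemma polar_approx (L : E →ₗ[ℝ] E) {β : ℝ} (hβ : β < 1)
    (hL : ∀ x, |‖L x‖ - ‖x‖| ≤ β * ‖x‖) :
    ∃ R : E → E, (∀ x y, ⟪R x, R y⟫ = ⟪x, y⟫) ∧ (∀ x, ‖L x - R x‖ ≤ β * ‖x‖) ∧
      ∀ z, (∀ x, ⟪L z, L x⟫ = ⟪z, x⟫) → R z = L z := by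
  set S : E →ₗ[ℝ] E := LinearMap.adjoint L ∘ₗ L with hS
  have hSi : ∀ x y, ⟪S x, y⟫ = ⟪L x, L y⟫ := fun x y => by
    simp [hS, LinearMap.adjoint_inner_left]
  have hsym : S.IsSymmetric := fun x y => by
    rw [hSi, real_inner_comm (S y) x, hSi, real_inner_comm]
  set v := hsym.eigenvectorBasis rfl with hv
  set a := hsym.eigenvalues rfl with ha
  have hSv : ∀ j, S (v j) = a j • v j := fun j => hsym.apply_eigenvectorBasis rfl j
  set σ : Fin (Module.finrank ℝ E) → ℝ := fun j => ‖L (v j)‖ with hσ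
  have hσβ : ∀ j, |σ j - 1| ≤ β := fun j => by
    have := hL (v j)
    rw [v.norm_eq_one, mul_one] at this
    exact this
  have hσp : ∀ j, 0 < σ j := fun j => by
    have := (abs_le.1 (hσβ j)).1; linarith
  have hLL : ∀ i j, ⟪L (v i), L (v j)⟫ = a i * ⟪v i, v j⟫ := fun i j => by
    rw [← hSi, hSv, inner_smul_left]; simp
  have hσa : ∀ j, σ j ^ 2 = a j := fun j => by
    have := hLL j j
    rw [real_inner_self_eq_norm_sq, real_inner_self_eq_norm_sq, v.norm_eq_one] at this
    simpa using this
  set q : Fin (Module.finrank ℝ E) → E := fun j => (σ j)⁻¹ • L (v j) with hq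
  have hqo : Orthonormal ℝ q := by
    rw [orthonormal_iff_ite]
    intro i j
    simp only [hq]
    rw [inner_smul_left, inner_smul_right, hLL, orthonormal_iff_ite.1 v.orthonormal i j]
    split_ifs with h
    · subst h
      rw [← hσa]; have := (hσp i).ne'; simp; field_simp
    · simp
  have hLx : ∀ x, L x = ∑ j, (⟪v j, x⟫ * σ j) • q j := fun x => by
    conv_lhs => rw [← v.sum_repr' x, map_sum]
    refine Finset.sum_congr rfl fun j _ => ?_
    simp only [hq]
    rw [map_smul, smul_smul, mul_assoc, mul_inv_cancel₀ (hσp j).ne', mul_one]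
  have hb0 : 0 ≤ β ∨ IsEmpty (Fin (Module.finrank ℝ E)) := by
    rcases isEmpty_or_nonempty (Fin (Module.finrank ℝ E)) with h | ⟨⟨j⟩⟩
    · exact Or.inr h
    · exact Or.inl ((abs_nonneg _).trans (hσβ j))
  refine ⟨fun x => ∑ j, ⟪v j, x⟫ • q j, ?_, ?_, ?_⟩
  · intro x y
    rw [hqo.inner_sum, ← v.sum_inner_mul_inner]
    refine Finset.sum_congr rfl fun j _ => ?_
    simp [real_inner_comm]
  · intro x
    rcases hb0 with hb0 | hemp
    · rw [hLx, ← Finset.sum_sub_distrib]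
      simp_rw [← sub_smul]
      apply le_of_sq_le_sq _ (by positivity)
      rw [← real_inner_self_eq_norm_sq, hqo.inner_sum, mul_pow, ← v.sum_sq_inner_right x,
        Finset.mul_sum]
      apply Finset.sum_le_sum
      intro j _
      have h1 := sq_le_sq' (by linarith [abs_nonneg (σ j - 1), hσβ j]) (hσβ j)
      rw [sq_abs] at h1
      simp only [conj_trivial]
      nlinarith [sq_nonneg ⟪v j, x⟫, mul_le_mul_of_nonneg_right h1 (sq_nonneg ⟪v j, x⟫)]
    · have hx : x = 0 := by
        rw [← v.sum_repr' x]; simp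
      subst hx; simp
  · intro z hz
    simp only
    rw [hLx]
    refine Finset.sum_congr rfl fun j _ => ?_
    have h1 : a j * ⟪v j, z⟫ = ⟪v j, z⟫ := by
      have := hz (v j)
      rw [real_inner_comm, ← hSi, hSv, inner_smul_left, real_inner_comm (v j) z] at this
      simpa using this
    by_cases h0 : ⟪v j, z⟫ = 0
    · simp [h0]
    · have h2 : a j = 1 := mul_right_cancel₀ h0 (by rw [h1, one_mul])
      have h3 : σ j = 1 := by
        have := hσa j; rw [h2] at this
        nlinarith [hσp j]
      rw [h3, mul_one]

lemma near_simplex {n : ℕ} (hn : 1 ≤ n) {e : EuclideanSpace ℝ (Fin (n + 1))} (he : ‖e‖ = 1)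
    {ut : Fin (n + 1) → EuclideanSpace ℝ (Fin (n + 1))} (hut : ∀ j, ‖ut j‖ = 1)
    (hue : ∀ j, ⟪ut j, e⟫ = (√((n : ℝ) + 1))⁻¹) {ρ : ℝ} (hρ0 : 0 < ρ) (hρ1 : ρ < 1)
    (h : ∀ i j, i ≠ j → |⟪ut i, ut j⟫| ≤ ρ ^ 2 / (64 * (n + 1))) :
    ∃ q : Fin (n + 1) → EuclideanSpace ℝ (Fin (n + 1)),
      (∀ i j, ⟪q i, q j⟫ = if i = j then (1:ℝ) else 0) ∧ (∀ j, ⟪q j, e⟫ = (√((n : ℝ) + 1))⁻¹) ∧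
      ∀ j, ‖ut j - q j‖ ≤ 17 / 64 * ρ := by
  set s : ℝ := √((n : ℝ) + 1) with hs
  have hs2 : s ^ 2 = n + 1 := Real.sq_sqrt (by positivity)
  have hs1 : 1 ≤ s := by rw [hs, Real.one_le_sqrt]; linarith [(Nat.cast_nonneg n : (0:ℝ) ≤ n)]
  have hs0 : 0 < s := by linarith
  set η : ℝ := ρ ^ 2 / (64 * (n + 1)) with hη
  have hη0 : 0 ≤ η := by positivity
  have hηD : η * (n + 1) = ρ ^ 2 / 64 := by rw [hη]; field_simp
  set b := EuclideanSpace.basisFun (Fin (n + 1)) ℝ with hb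
  have hoff : ∀ x : Fin (n + 1) → ℝ,
      |∑ i, ∑ j, x i * x j * ⟪ut i, ut j⟫ - ∑ i, x i ^ 2| ≤ ρ ^ 2 / 64 * ∑ i, x i ^ 2 := by
    intro x
    have h1 : ∑ i, ∑ j, x i * x j * ⟪ut i, ut j⟫ - ∑ i, x i ^ 2 =
        ∑ i, ∑ j, x i * x j * (if i = j then 0 else ⟪ut i, ut j⟫) := by
      rw [← Finset.sum_sub_distrib]
      refine Finset.sum_congr rfl fun i _ => ?_
      rw [sub_eq_iff_eq_add]
      have : x i ^ 2 = ∑ j, x i * x j * (if i = j then (1:ℝ) else 0) := by simp [sq]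
      rw [this, ← Finset.sum_add_distrib]
      refine Finset.sum_congr rfl fun j _ => ?_
      split_ifs with hij
      · subst hij; rw [real_inner_self_eq_norm_sq, hut]; ring
      · ring
    rw [h1]
    calc _ ≤ ∑ i, ∑ j, |x i| * |x j| * η := by
          refine (Finset.abs_sum_le_sum_abs _ _).trans (Finset.sum_le_sum fun i _ => ?_)
          refine (Finset.abs_sum_le_sum_abs _ _).trans (Finset.sum_le_sum fun j _ => ?_)
          rw [abs_mul, abs_mul]
          apply mul_le_mul_of_nonneg_left _ (by positivity)
          split_ifs with hij
          · simpa using hη0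
          · exact h i j hij
      _ = η * (∑ i, |x i|) ^ 2 := by
          rw [sq, Finset.sum_mul_sum, Finset.mul_sum]
          refine Finset.sum_congr rfl fun i _ => ?_
          rw [Finset.mul_sum]
          refine Finset.sum_congr rfl fun j _ => ?_
          ring
      _ ≤ η * ((n + 1) * ∑ i, x i ^ 2) := by
          apply mul_le_mul_of_nonneg_left _ hη0
          have := sq_sum_le_card_mul_sum_sq (s := Finset.univ) (f := fun i => |x i|)
          simpa using this
      _ = _ := by rw [← mul_assoc, hηD]
  have hnormsum : ∀ x : Fin (n + 1) → ℝ, ‖∑ i, x i • ut i‖ ^ 2 =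
      ∑ i, ∑ j, x i * x j * ⟪ut i, ut j⟫ := by
    intro x
    rw [← real_inner_self_eq_norm_sq, sum_inner]
    refine Finset.sum_congr rfl fun i _ => ?_
    rw [inner_sum]
    refine Finset.sum_congr rfl fun j _ => ?_
    rw [inner_smul_left, inner_smul_right]; simp; ring
  set d : EuclideanSpace ℝ (Fin (n + 1)) := ∑ j, s⁻¹ • ut j - e with hd
  have hde0 : ⟪∑ j, s⁻¹ • ut j, e⟫ = 1 := by
    rw [sum_inner]
    simp_rw [inner_smul_left, hue]
    simp
    field_simp
    linarith
  have hde : ⟪d, e⟫ = 0 := by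
    rw [hd, inner_sub_left, hde0, real_inner_self_eq_norm_sq, he]; norm_num
  have hdn : ‖d‖ ≤ ρ / 8 := by
    apply le_of_sq_le_sq _ (by positivity)
    have h1 := hoff fun _ => s⁻¹
    have h2 : ∑ _i : Fin (n + 1), (s⁻¹) ^ 2 = 1 := by
      simp; field_simp; linarith
    rw [h2, ← hnormsum (fun _ => s⁻¹)] at h1
    have h3 : ‖d‖ ^ 2 = ‖∑ j, s⁻¹ • ut j‖ ^ 2 - 2 * ⟪∑ j, s⁻¹ • ut j, e⟫ + ‖e‖ ^ 2 :=
      norm_sub_sq_real _ _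
    rw [h3, hde0, he]
    have := (abs_le.1 h1).2
    nlinarith
  set z : Fin (n + 1) → EuclideanSpace ℝ (Fin (n + 1)) := fun j => ut j - s⁻¹ • d with hz
  set L : EuclideanSpace ℝ (Fin (n + 1)) →ₗ[ℝ] EuclideanSpace ℝ (Fin (n + 1)) :=
    b.toBasis.constr ℝ z with hL
  have hLb : ∀ j, L (b j) = z j := fun j => by
    have := b.toBasis.constr_basis ℝ z j
    rwa [b.coe_toBasis] at this
  have hLx : ∀ x, L x = ∑ j, ⟪b j, x⟫ • z j := fun x => by
    conv_lhs => rw [← b.sum_repr' x, map_sum]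
    simp [hLb]
  set o : EuclideanSpace ℝ (Fin (n + 1)) := ∑ j, s⁻¹ • b j with ho
  have hbo : ∀ j, ⟪b j, o⟫ = s⁻¹ := fun j => by
    rw [ho, inner_sum]
    simp_rw [inner_smul_right, orthonormal_iff_ite.1 b.orthonormal]
    simp
  have hox : ∀ x, ⟪o, x⟫ = s⁻¹ * ∑ j, ⟪b j, x⟫ := fun x => by
    rw [ho, sum_inner, Finset.mul_sum]
    simp [inner_smul_left]
  have hon : ‖o‖ = 1 := by
    have : ‖o‖ ^ 2 = 1 := by
      rw [← real_inner_self_eq_norm_sq, hox]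
      simp_rw [hbo]
      simp; field_simp; linarith
    nlinarith [norm_nonneg o]
  have hLo : L o = e := by
    rw [hLx]
    simp_rw [hbo, hz, smul_sub, Finset.sum_sub_distrib]
    have : ∑ _i : Fin (n + 1), s⁻¹ • s⁻¹ • d = d := by
      simp only [Finset.sum_const, Finset.card_univ, Fintype.card_fin]
      rw [← Nat.cast_smul_eq_nsmul ℝ, smul_smul, smul_smul]
      have : (((n + 1 : ℕ) : ℝ) * s⁻¹ * s⁻¹) = 1 := by
        push_cast; field_simp; linarith
      rw [this, one_smul]
    rw [this, hd]; abel
  have hze : ∀ j, ⟪z j, e⟫ = s⁻¹ := fun j => by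
    simp only [hz]
    rw [inner_sub_left, inner_smul_left, hde, hue]; simp
  have hLiso : ∀ x, ⟪L o, L x⟫ = ⟪o, x⟫ := fun x => by
    rw [hLo, hLx, inner_sum, hox, Finset.mul_sum]
    refine Finset.sum_congr rfl fun j _ => ?_
    rw [inner_smul_right, real_inner_comm (z j) e, hze]; ring
  have hLβ : ∀ x, |‖L x‖ - ‖x‖| ≤ (ρ ^ 2 / 64 + ρ / 8) * ‖x‖ := fun x => by
    set Bx := ∑ j, ⟪b j, x⟫ • ut j with hBx
    have h1 : |‖Bx‖ ^ 2 - ‖x‖ ^ 2| ≤ ρ ^ 2 / 64 * ‖x‖ ^ 2 := by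
      have := hoff fun j => ⟪b j, x⟫
      rw [← hnormsum (fun j => ⟪b j, x⟫), b.sum_sq_inner_right] at this
      exact this
    have h2 : |‖Bx‖ - ‖x‖| ≤ ρ ^ 2 / 64 * ‖x‖ := by
      rcases (norm_nonneg x).eq_or_lt with h0 | h0
      · rw [← h0] at h1 ⊢
        have : ‖Bx‖ = 0 := by
          have := abs_nonpos_iff.1 (by simpa using h1 : |‖Bx‖ ^ 2| ≤ 0)
          simpa using this
        rw [this]; simp
      · have e1 : ‖Bx‖ ^ 2 - ‖x‖ ^ 2 = (‖Bx‖ - ‖x‖) * (‖Bx‖ + ‖x‖) := by ring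
        rw [e1, abs_mul, abs_of_nonneg (by positivity : (0:ℝ) ≤ ‖Bx‖ + ‖x‖)] at h1
        have e2 : |‖Bx‖ - ‖x‖| * ‖x‖ ≤ ρ ^ 2 / 64 * ‖x‖ * ‖x‖ := by
          have := mul_le_mul_of_nonneg_left (le_add_of_nonneg_left (norm_nonneg Bx) : ‖x‖ ≤ _)
            (abs_nonneg (‖Bx‖ - ‖x‖))
          nlinarith
        exact le_of_mul_le_mul_right e2 h0
    have h3 : L x - Bx = -(⟪o, x⟫ • d) := by
      rw [hLx, hBx, ← Finset.sum_sub_distrib, hox, Finset.mul_sum, Finset.sum_smul,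
        ← Finset.sum_neg_distrib]
      refine Finset.sum_congr rfl fun j _ => ?_
      simp only [hz]
      rw [smul_sub, smul_smul, mul_comm]; abel
    have h4 : ‖L x - Bx‖ ≤ ρ / 8 * ‖x‖ := by
      rw [h3, norm_neg, norm_smul, Real.norm_eq_abs]
      have := abs_real_inner_le_norm o x
      rw [hon, one_mul] at this
      calc _ ≤ ‖x‖ * (ρ / 8) := mul_le_mul this hdn (norm_nonneg _) (norm_nonneg _)
        _ = _ := mul_comm _ _
    have h5 := abs_norm_sub_norm_le (L x) Bx
    have h6 := abs_sub_le ‖L x‖ ‖Bx‖ ‖x‖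
    linarith
  have hβ1 : ρ ^ 2 / 64 + ρ / 8 < 1 := by nlinarith
  obtain ⟨R, hR1, hR2, hR3⟩ := polar_approx L hβ1 hLβ
  refine ⟨fun j => R (b j), ?_, ?_, ?_⟩
  · intro i j
    rw [hR1, orthonormal_iff_ite.1 b.orthonormal]
  · intro j
    rw [← hLo, ← hR3 o hLiso, hR1, hbo]
  · intro j
    have h1 := hR2 (b j)
    rw [hLb, b.norm_eq_one, mul_one] at h1
    have h2 : ‖ut j - z j‖ ≤ ρ / 8 := by
      have : ut j - z j = s⁻¹ • d := by simp only [hz]; abel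
      rw [this, norm_smul, Real.norm_of_nonneg (by positivity)]
      have : s⁻¹ ≤ 1 := inv_le_one_of_one_le₀ hs1
      calc _ ≤ 1 * ‖d‖ := by gcongr
        _ ≤ _ := by linarith
    have h3 := norm_add_le (ut j - z j) (z j - R (b j))
    rw [sub_add_sub_cancel] at h3
    nlinarith

lemma angle_lt_of_norm_sub {F : Type*} [NormedAddCommGroup F] [InnerProductSpace ℝ F]
    {u w : F} (hu : ‖u‖ = 1) (hw : ‖w‖ = 1) {ρ : ℝ} (hρ0 : 0 < ρ) (hρ1 : ρ < 1)
    (h : ‖u - w‖ ≤ ρ / 2) : InnerProductGeometry.angle u w < ρ := by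
  by_contra! hlt
  have h1 : Real.cos (InnerProductGeometry.angle u w) ≤ Real.cos ρ :=
    Real.cos_le_cos_of_nonneg_of_le_pi hρ0.le (InnerProductGeometry.angle_le_pi u w) hlt
  rw [InnerProductGeometry.cos_angle, hu, hw] at h1
  have h2 := norm_sub_sq_real u w
  rw [hu, hw] at h2
  have h3 := (abs_le.1 (Real.cos_bound (x := ρ) (by rw [abs_of_pos hρ0]; exact hρ1.le))).2
  rw [abs_of_pos hρ0] at h3
  have h4 : ‖u - w‖ ^ 2 ≤ (ρ / 2) ^ 2 := pow_le_pow_left₀ (norm_nonneg _) h 2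
  have h5 : ρ ^ 4 ≤ ρ ^ 2 := pow_le_pow_of_le_one hρ0.le hρ1.le (by norm_num)
  have h6 : 0 < ρ ^ 2 := by positivity
  simp at h1
  nlinarith

end geometry

section assembly

lemma sum_coeff {n k : ℕ} {e : EuclideanSpace ℝ (Fin (n + 1))} (he : ‖e‖ = 1)
    {u : Fin k → EuclideanSpace ℝ (Fin (n + 1))}
    (hu : ∀ i, ‖u i‖ = 1) (hue : ∀ i, ⟪u i, e⟫ = 0) {c : Fin k → ℝ}
    (hiso : ∀ x : EuclideanSpace ℝ (Fin (n + 1)),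
      ⟪x, e⟫ = 0 → ‖x‖ ^ 2 = ∑ i, c i * ⟪u i, x⟫ ^ 2) : ∑ i, c i = n := by
  set b := EuclideanSpace.basisFun (Fin (n + 1)) ℝ with hb
  have hee : ⟪e, e⟫ = 1 := by rw [real_inner_self_eq_norm_sq, he]; norm_num
  have h1 : ∀ j, 1 - ⟪b j, e⟫ ^ 2 = ∑ i, c i * ⟪u i, b j⟫ ^ 2 := by
    intro j
    have h2 := hiso (b j - ⟪b j, e⟫ • e) (by
      rw [inner_sub_left, real_inner_smul_left, hee]; ring)
    have h3 : ∀ i, ⟪u i, b j - ⟪b j, e⟫ • e⟫ = ⟪u i, b j⟫ := by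
      intro i
      rw [inner_sub_right, real_inner_smul_right, hue i]; ring
    simp_rw [h3] at h2
    rw [← h2, @norm_sub_sq_real, real_inner_smul_right, norm_smul, he, b.orthonormal.1 j,
      Real.norm_eq_abs, mul_one, sq_abs]
    ring
  have h4 : ∑ j, (1 - ⟪b j, e⟫ ^ 2) = ∑ j, ∑ i, c i * ⟪u i, b j⟫ ^ 2 :=
    Finset.sum_congr rfl fun j _ => h1 j
  rw [Finset.sum_comm, Finset.sum_sub_distrib] at h4
  have hpars : ∀ x : EuclideanSpace ℝ (Fin (n + 1)), ∑ j, ⟪x, b j⟫ ^ 2 = ‖x‖ ^ 2 := by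
    intro x
    have := b.sum_sq_norm_inner_left x
    rw [← this]
    exact Finset.sum_congr rfl fun j _ => by rw [Real.norm_eq_abs, sq_abs]
  have h5 : ∑ j, ⟪b j, e⟫ ^ 2 = 1 := by
    have := hpars e
    rw [he] at this
    simp_rw [real_inner_comm] at this ⊢
    rw [this]; norm_num
  have h6 : ∀ i, ∑ j, c i * ⟪u i, b j⟫ ^ 2 = c i := by
    intro i
    rw [← Finset.mul_sum, hpars, hu]; norm_num
  simp_rw [h6] at h4
  rw [← h4, h5]; simp

lemma tilde_norm {n : ℕ} {e v vt : EuclideanSpace ℝ (Fin (n + 1))} (he : ‖e‖ = 1)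
    (hv : ⟪v, e⟫ = 0)
    (hvt : vt = Real.sqrt ((n : ℝ) / (n + 1)) • v + (Real.sqrt (n + 1))⁻¹ • e) :
    ⟪vt, e⟫ = (√((n : ℝ) + 1))⁻¹ := by
  rw [hvt, inner_add_left, real_inner_smul_left, real_inner_smul_left, hv,
    real_inner_self_eq_norm_sq, he]; norm_num

lemma tilde_inner {n : ℕ} {e v vt w wt : EuclideanSpace ℝ (Fin (n + 1))}
    (he : ‖e‖ = 1) (hv : ⟪v, e⟫ = 0) (hw : ⟪w, e⟫ = 0)
    (hvt : vt = Real.sqrt ((n : ℝ) / (n + 1)) • v + (Real.sqrt (n + 1))⁻¹ • e)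
    (hwt : wt = Real.sqrt ((n : ℝ) / (n + 1)) • w + (Real.sqrt (n + 1))⁻¹ • e) :
    ⟪vt, wt⟫ = (n * ⟪v, w⟫ + 1) / (n + 1) := by
  have hw' : ⟪e, w⟫ = 0 := by rw [real_inner_comm]; exact hw
  have hee : ⟪e, e⟫ = 1 := by rw [real_inner_self_eq_norm_sq, he]; norm_num
  have h1 : √((n : ℝ) / (n + 1)) ^ 2 = n / (n + 1) := Real.sq_sqrt (by positivity)
  have h2 : (√((n : ℝ) + 1))⁻¹ ^ 2 = 1 / (n + 1) := by
    rw [inv_pow, Real.sq_sqrt (by positivity), one_div]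
  have h3 : ⟪vt, wt⟫ = √((n : ℝ) / (n + 1)) ^ 2 * ⟪v, w⟫ + (√((n : ℝ) + 1))⁻¹ ^ 2 := by
    rw [hvt, hwt]
    simp only [inner_add_left, inner_add_right, real_inner_smul_left, real_inner_smul_right, hv,
      hw', hee]
    ring
  rw [h3, h1, h2]; ring

lemma tilde_iso {n k : ℕ} (hn : 1 ≤ n) {e : EuclideanSpace ℝ (Fin (n + 1))} (he : ‖e‖ = 1)
    {u : Fin k → EuclideanSpace ℝ (Fin (n + 1))}
    (hu : ∀ i, ‖u i‖ = 1) (hue : ∀ i, ⟪u i, e⟫ = 0) {c : Fin k → ℝ}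
    (hiso : ∀ x : EuclideanSpace ℝ (Fin (n + 1)),
      ⟪x, e⟫ = 0 → ‖x‖ ^ 2 = ∑ i, c i * ⟪u i, x⟫ ^ 2)
    (hcent : ∑ i, c i • u i = 0)
    {ut : Fin k → EuclideanSpace ℝ (Fin (n + 1))}
    (hut : ∀ i, ut i = Real.sqrt ((n : ℝ) / (n + 1)) • u i + (Real.sqrt (n + 1))⁻¹ • e)
    {ct : Fin k → ℝ} (hct : ∀ i, ct i = ((n : ℝ) + 1) / n * c i)
    (x : EuclideanSpace ℝ (Fin (n + 1))) : ∑ i, ct i * ⟪ut i, x⟫ ^ 2 = ‖x‖ ^ 2 := by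
  have hee : ⟪e, e⟫ = 1 := by rw [real_inner_self_eq_norm_sq, he]; norm_num
  have hsum := sum_coeff he hu hue hiso
  have hn0 : (n : ℝ) ≠ 0 := by positivity
  set A := √((n : ℝ) / (n + 1)) with hA
  set B := (√((n : ℝ) + 1))⁻¹ with hB
  have h1 : A ^ 2 = n / (n + 1) := Real.sq_sqrt (by positivity)
  have h2 : B ^ 2 = 1 / (n + 1) := by
    rw [hB, inv_pow, Real.sq_sqrt (by positivity), one_div]
  have h3 : ∀ i, ⟪ut i, x⟫ = A * ⟪u i, x⟫ + B * ⟪e, x⟫ := by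
    intro i; rw [hut, inner_add_left, real_inner_smul_left, real_inner_smul_left]
  have hc0 : ∑ i, c i * ⟪u i, x⟫ = 0 := by
    have : ⟪∑ i, c i • u i, x⟫ = 0 := by rw [hcent, inner_zero_left]
    rw [sum_inner] at this
    simpa only [real_inner_smul_left] using this
  have h4 : ∑ i, c i * ⟪u i, x⟫ ^ 2 = ‖x‖ ^ 2 - ⟪e, x⟫ ^ 2 := by
    have h2 := hiso (x - ⟪x, e⟫ • e) (by
      rw [inner_sub_left, real_inner_smul_left, hee]; ring)
    have h3 : ∀ i, ⟪u i, x - ⟪x, e⟫ • e⟫ = ⟪u i, x⟫ := by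
      intro i
      rw [inner_sub_right, real_inner_smul_right, hue i]; ring
    simp_rw [h3] at h2
    rw [← h2, @norm_sub_sq_real, real_inner_smul_right, norm_smul, he,
      Real.norm_eq_abs, mul_one, sq_abs, real_inner_comm x e]
    ring
  have h5 : ∑ i, ct i * ⟪ut i, x⟫ ^ 2 = ((n : ℝ) + 1) / n * (A ^ 2 * ∑ i, c i * ⟪u i, x⟫ ^ 2 +
      2 * A * B * ⟪e, x⟫ * ∑ i, c i * ⟪u i, x⟫ + B ^ 2 * ⟪e, x⟫ ^ 2 * ∑ i, c i) := by
    simp only [Finset.mul_sum, ← Finset.sum_add_distrib]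
    refine Finset.sum_congr rfl fun i _ => ?_
    rw [hct, h3]; ring
  rw [h5, hc0, h4, h1, h2, hsum]
  field_simp
  ring

/-- The combinatorial core: a well-separated pair of non-orthogonal lifted vectors. -/
lemma exists_pair {n k : ℕ} (hn : 1 ≤ n)
    {e : EuclideanSpace ℝ (Fin (n + 1))} (he : ‖e‖ = 1)
    {u : Fin k → EuclideanSpace ℝ (Fin (n + 1))}
    (hu : ∀ i, ‖u i‖ = 1) (hue : ∀ i, ⟪u i, e⟫ = 0)
    {ut : Fin k → EuclideanSpace ℝ (Fin (n + 1))}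
    (hut : ∀ i, ut i = Real.sqrt ((n : ℝ) / (n + 1)) • u i + (Real.sqrt (n + 1))⁻¹ • e)
    (hut1 : ∀ i, ‖ut i‖ = 1)
    {ct : Fin k → ℝ} (hct0 : ∀ i, 0 < ct i)
    (hisot : ∀ x, ∑ i, ct i * ⟪ut i, x⟫ ^ 2 = ‖x‖ ^ 2)
    {ρ : ℝ} (hρ0 : 0 < ρ) (hρ1 : ρ < 1)
    (hsep : ∀ w : Fin (n + 1) → EuclideanSpace ℝ (Fin (n + 1)),
      (∀ j, ‖w j‖ = 1) → (∀ j, ⟪w j, e⟫ = 0) →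
      (∀ j j', j ≠ j' → ⟪w j, w j'⟫ = -1 / n) →
      ∀ idx : Fin (n + 1) → Fin k, Function.Injective idx →
        ∃ j, ρ ≤ InnerProductGeometry.angle (u (idx j)) (w j)) :
    ∃ a b, (k : ℝ)⁻¹ ≤ ct a ∧ (k : ℝ)⁻¹ ≤ ct b ∧ (k : ℝ)⁻¹ ≤ ‖ut a - ut b‖ ^ 2 ∧
      ρ ^ 2 / (64 * (n + 1)) < |⟪ut a, ut b⟫| := by
  obtain ⟨idx, h1, h2⟩ := select_frame hut1 hct0 hisot (D := n + 1) (by simp) (n + 1) le_rfl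
  rw [Fintype.card_fin] at h1 h2
  have hk : 0 < (k : ℝ)⁻¹ := by
    have : 0 < k := (Nat.zero_le _).trans_lt (idx 0).isLt
    positivity
  by_contra! hcon
  have hinj : Function.Injective idx := by
    intro j j' hjj
    by_contra hne
    have := h2 j j' hne
    rw [hjj, sub_self, norm_zero, zero_pow two_ne_zero] at this
    linarith
  obtain ⟨q, hq1, hq2, hq3⟩ := near_simplex hn he (ut := fun j => ut (idx j)) (fun j => hut1 _)
    (fun j => tilde_norm he (hue _) (hut _)) hρ0 hρ1
    (fun i j hij => hcon _ _ (h1 i) (h1 j) (h2 i j hij))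
  have hee : ⟪e, e⟫ = 1 := by rw [real_inner_self_eq_norm_sq, he]; norm_num
  have hnp : (0 : ℝ) < n := by positivity
  set A := √((n : ℝ) / (n + 1)) with hA
  set B := (√((n : ℝ) + 1))⁻¹ with hB
  have hA2 : A ^ 2 = n / (n + 1) := Real.sq_sqrt (by positivity)
  have hB2 : B ^ 2 = 1 / (n + 1) := by
    rw [hB, inv_pow, Real.sq_sqrt (by positivity), one_div]
  have hA0 : 0 < A := Real.sqrt_pos.2 (by positivity)
  set w : Fin (n + 1) → EuclideanSpace ℝ (Fin (n + 1)) := fun j => A⁻¹ • (q j - B • e) with hw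
  have hww : ∀ i j, ⟪w i, w j⟫ = ((n : ℝ) + 1) / n * ((if i = j then (1:ℝ) else 0) - 1 / (n + 1)) := by
    intro i j
    have e1 : ⟪w i, w j⟫ = (A ^ 2)⁻¹ * ((if i = j then (1:ℝ) else 0) - B ^ 2) := by
      simp only [hw, real_inner_smul_left, real_inner_smul_right, inner_sub_left, inner_sub_right,
        hq1, hq2, hee, real_inner_comm (q j) e]
      ring
    rw [e1, hA2, hB2, inv_div]
  have hw1 : ∀ j, ‖w j‖ = 1 := by
    intro j
    have := hww j j
    rw [real_inner_self_eq_norm_sq, if_pos rfl] at this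
    have h3 : ((n : ℝ) + 1) / n * (1 - 1 / (n + 1)) = 1 := by field_simp; ring
    rw [h3] at this
    nlinarith [norm_nonneg (w j)]
  obtain ⟨j, hj⟩ := hsep w hw1 (fun j => by
      simp only [hw, real_inner_smul_left, inner_sub_left, hq2, hee]; ring)
    (fun i j hij => by rw [hww, if_neg hij]; field_simp; ring) idx hinj
  refine absurd hj (not_le.2 (angle_lt_of_norm_sub (hu _) (hw1 j) hρ0 hρ1 ?_))
  have e1 : u (idx j) - w j = A⁻¹ • (ut (idx j) - q j) := by
    rw [hut]
    simp only [hw]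
    have : u (idx j) = A⁻¹ • (A • u (idx j)) := by rw [smul_smul, inv_mul_cancel₀ hA0.ne', one_smul]
    conv_lhs => rw [this]
    rw [← smul_sub]
    congr 1
    abel
  rw [e1, norm_smul, Real.norm_eq_abs, abs_of_pos (inv_pos.2 hA0)]
  have e2 : A⁻¹ ≤ 3 / 2 := by
    rw [inv_le_comm₀ hA0 (by norm_num)]
    apply Real.le_sqrt_of_sq_le
    rw [le_div_iff₀ (by positivity)]
    have : (1:ℝ) ≤ n := by exact_mod_cast hn
    nlinarith
  calc A⁻¹ * ‖ut (idx j) - q j‖ ≤ 3 / 2 * (17 / 64 * ρ) :=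
        mul_le_mul e2 (hq3 j) (norm_nonneg _) (by norm_num)
    _ ≤ ρ / 2 := by linarith

lemma not_one {k : ℕ} {e : EuclideanSpace ℝ (Fin (1 + 1))} (he : ‖e‖ = 1)
    {u : Fin k → EuclideanSpace ℝ (Fin (1 + 1))}
    (hu : ∀ i, ‖u i‖ = 1) (hue : ∀ i, ⟪u i, e⟫ = 0) {c : Fin k → ℝ} (hc : ∀ i, 0 < c i)
    (hiso : ∀ x : EuclideanSpace ℝ (Fin (1 + 1)),
      ⟪x, e⟫ = 0 → ‖x‖ ^ 2 = ∑ i, c i * ⟪u i, x⟫ ^ 2) (a b : Fin k) (hab : u a ≠ u b) :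
    ⟪u a, u b⟫ = -1 := by
  have hsum := sum_coeff he hu hue hiso
  have h1 := hiso (u b) (hue b)
  rw [hu b] at h1
  have hle : ∀ i, ⟪u i, u b⟫ ^ 2 ≤ 1 := by
    intro i
    have := abs_real_inner_le_norm (u i) (u b)
    rw [hu, hu] at this
    rw [← sq_abs]
    nlinarith [abs_nonneg ⟪u i, u b⟫]
  have h2 : ∑ i, c i * (1 - ⟪u i, u b⟫ ^ 2) = 0 := by
    simp_rw [mul_sub]
    rw [Finset.sum_sub_distrib, ← h1]
    simp [hsum]
  have h3 := (Finset.sum_eq_zero_iff_of_nonneg (fun i _ =>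
    mul_nonneg (hc i).le (sub_nonneg.2 (hle i)))).1 h2 a (Finset.mem_univ _)
  have h4 : ⟪u a, u b⟫ ^ 2 = 1 := by
    have := (mul_eq_zero.1 h3).resolve_left (hc a).ne'
    linarith
  rcases eq_or_eq_neg_of_sq_eq_sq _ _ (h4.trans (one_pow 2).symm) with h | h
  · exact absurd ((inner_eq_one_iff_of_norm_eq_one (hu a) (hu b)).1 h) hab
  · exact h


lemma nat_const_bound {n k : ℕ} (hn : 2 ≤ n) (hk : k ≤ 2 * n ^ 2) :
    (320 * (n + 1)) ^ (n + 1) * (33554432000000 * (n + 1) ^ 2 * k ^ 2) ≤ n ^ (56 * n) := by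
  have hp : ∀ m, 2 ^ m ≤ n ^ m := fun m => Nat.pow_le_pow_left hn m
  have hD2 : n + 1 ≤ n ^ 2 := by nlinarith
  have h1 : 320 * (n + 1) ≤ n ^ 11 := by
    calc 320 * (n + 1) ≤ 2 ^ 9 * n ^ 2 := Nat.mul_le_mul (by norm_num) hD2
      _ ≤ n ^ 9 * n ^ 2 := Nat.mul_le_mul_right _ (hp 9)
      _ = n ^ 11 := by ring
  have h2 : (320 * (n + 1)) ^ (n + 1) ≤ n ^ (22 * n) := by
    calc (320 * (n + 1)) ^ (n + 1) ≤ (n ^ 11) ^ (n + 1) := Nat.pow_le_pow_left h1 _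
      _ = n ^ (11 * (n + 1)) := by rw [← pow_mul]
      _ ≤ n ^ (22 * n) := Nat.pow_le_pow_right (by omega) (by omega)
  have h3 : 33554432000000 * (n + 1) ^ 2 * k ^ 2 ≤ n ^ 55 := by
    calc 33554432000000 * (n + 1) ^ 2 * k ^ 2 ≤ 2 ^ 45 * (n ^ 2) ^ 2 * (2 * n ^ 2) ^ 2 :=
          Nat.mul_le_mul (Nat.mul_le_mul (by norm_num) (Nat.pow_le_pow_left hD2 2))
            (Nat.pow_le_pow_left hk 2)
      _ = 2 ^ 47 * n ^ 8 := by ring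
      _ ≤ n ^ 47 * n ^ 8 := Nat.mul_le_mul_right _ (hp 47)
      _ = n ^ 55 := by ring
  calc _ ≤ n ^ (22 * n) * n ^ 55 := Nat.mul_le_mul h2 h3
    _ = n ^ (22 * n + 55) := by rw [← pow_add]
    _ ≤ n ^ (56 * n) := Nat.pow_le_pow_right (by omega) (by omega)

lemma volume_ball_lower {n : ℕ} (hn : 2 ≤ n) (x : EuclideanSpace ℝ (Fin (n + 1))) :
    ENNReal.ofReal (((80 * ((n : ℝ) + 1)) ^ (n + 1))⁻¹) ≤ volume (ball x ((1/20 : ℝ) / 4)) := by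
  rw [EuclideanSpace.volume_ball, Fintype.card_fin, ← ENNReal.ofReal_pow (by norm_num),
    ← ENNReal.ofReal_mul (by positivity)]
  apply ENNReal.ofReal_le_ofReal
  have hn2 : (2:ℝ) ≤ n := by exact_mod_cast hn
  have h1 : Real.Gamma (((n + 1 : ℕ) : ℝ) / 2 + 1) ≤ ((n : ℝ) + 1) ^ (n + 1) := by
    calc Real.Gamma (((n + 1 : ℕ) : ℝ) / 2 + 1) ≤ Real.Gamma (((n + 1 : ℕ) : ℝ) + 1) := by
          apply Real.Gamma_strictMonoOn_Ici.monotoneOn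
          · push_cast; simp only [mem_Ici]; linarith
          · push_cast; simp only [mem_Ici]; linarith
          · push_cast; linarith
      _ = ((n + 1).factorial : ℝ) := Real.Gamma_nat_eq_factorial _
      _ ≤ (((n + 1) ^ (n + 1) : ℕ) : ℝ) := by exact_mod_cast Nat.factorial_le_pow _
      _ = _ := by push_cast; rfl
  have h2 : 0 < Real.Gamma (((n + 1 : ℕ) : ℝ) / 2 + 1) := Real.Gamma_pos_of_pos (by positivity)
  have h3 : (1:ℝ) ≤ √Real.pi ^ (n + 1) := by
    apply one_le_pow₀
    rw [Real.one_le_sqrt]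
    linarith [Real.pi_gt_three]
  rw [mul_pow, mul_inv, ← inv_pow]
  apply mul_le_mul _ _ (by positivity) (by positivity)
  · norm_num
  · rw [inv_eq_one_div]
    exact div_le_div₀ (by positivity) h3 h2 h1

lemma gain_bound {n k : ℕ} (hn : 2 ≤ n) (hk0 : 0 < k) (hk : k ≤ 2 * n ^ 2) {ρ : ℝ}
    (x : EuclideanSpace ℝ (Fin (n + 1))) :
    ENNReal.ofReal (((n : ℝ) ^ (56 * n))⁻¹ * ρ ^ 4) ≤
      ENNReal.ofReal ((1/4 : ℝ) ^ (n + 1) * ((8 * (16:ℝ) ^ 2)⁻¹ * (k : ℝ)⁻¹ *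
        (ρ ^ 2 / (64 * (n + 1))) ^ 2 * (1/25 * ((1/20 : ℝ) / 4 * √((k : ℝ)⁻¹))) ^ 2)) *
      volume (ball x ((1/20 : ℝ) / 4)) := by
  refine le_trans ?_ (mul_le_mul_right (volume_ball_lower hn x) _)
  rw [← ENNReal.ofReal_mul (by positivity)]
  apply ENNReal.ofReal_le_ofReal
  have hk' : (0:ℝ) < k := by exact_mod_cast hk0
  have h1 : √((k : ℝ)⁻¹) ^ 2 = (k : ℝ)⁻¹ := Real.sq_sqrt (by positivity)
  have h2 : (1/4 : ℝ) ^ (n + 1) * ((8 * (16:ℝ) ^ 2)⁻¹ * (k : ℝ)⁻¹ *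
        (ρ ^ 2 / (64 * (n + 1))) ^ 2 * (1/25 * ((1/20 : ℝ) / 4 * √((k : ℝ)⁻¹))) ^ 2) *
        ((80 * ((n : ℝ) + 1)) ^ (n + 1))⁻¹ =
      ((320 * ((n:ℝ) + 1)) ^ (n + 1) * (33554432000000 * ((n:ℝ) + 1) ^ 2 * k ^ 2))⁻¹ * ρ ^ 4 := by
    have e1 : (320 * ((n:ℝ) + 1)) ^ (n + 1) = 4 ^ (n + 1) * (80 * ((n : ℝ) + 1)) ^ (n + 1) := by
      rw [← mul_pow]; congr 1; ring
    rw [e1, mul_pow (1/25 : ℝ), mul_pow ((1/20 : ℝ)/4), h1, one_div_pow]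
    field_simp
    ring
  rw [h2]
  apply mul_le_mul_of_nonneg_right _ (by positivity)
  apply inv_anti₀ (by positivity)
  exact_mod_cast nat_const_bound hn hk


lemma lintegral_gauss (n : ℕ) :
    ∫⁻ x : EuclideanSpace ℝ (Fin (n + 1)),
      ENNReal.ofReal ((WW ^ (n + 1))⁻¹ * Real.exp (-‖x‖ ^ 2 / 2)) = 1 := by
  have hWpos := WW_pos
  have h1 : ∫ x : EuclideanSpace ℝ (Fin (n + 1)), Real.exp (-‖x‖ ^ 2 / 2) = WW ^ (n + 1) := by
    have h2 := GaussianFourier.integral_rexp_neg_mul_sq_norm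
      (V := EuclideanSpace ℝ (Fin (n + 1))) (b := 1/2) (by norm_num)
    have h3 : (fun x : EuclideanSpace ℝ (Fin (n + 1)) => Real.exp (-(1/2) * ‖x‖ ^ 2)) =
        fun x => Real.exp (-‖x‖ ^ 2 / 2) := by ext x; congr 1; ring
    rw [h3] at h2
    rw [h2, finrank_euclideanSpace_fin, WW]
    have h4 : Real.pi / (1/2) = 2 * Real.pi := by ring
    rw [h4, Real.sqrt_eq_rpow, ← Real.rpow_natCast, ← Real.rpow_mul (by positivity)]
    congr 1; ring
  have hGint : Integrable (fun x : EuclideanSpace ℝ (Fin (n + 1)) => Real.exp (-‖x‖ ^ 2 / 2)) := by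
    apply Integrable.of_integral_ne_zero
    rw [h1]; positivity
  rw [← ofReal_integral_eq_lintegral_ofReal (hGint.const_mul _)
    (Filter.Eventually.of_forall fun x => by positivity), integral_const_mul, h1,
    inv_mul_cancel₀ (by positivity), ENNReal.ofReal_one]

lemma prod_div {k D : ℕ} {c : Fin k → ℝ} (hD : ∑ i, c i = D) {Z : ℝ} (hZ : 0 < Z)
    {g : Fin k → ℝ} (hg : ∀ i, 0 ≤ g i) :
    ∏ i, (g i / Z) ^ c i = (Z ^ D)⁻¹ * ∏ i, g i ^ c i := by
  simp_rw [fun i => Real.div_rpow (hg i) hZ.le (c i)]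
  rw [Finset.prod_div_distrib, ← Real.rpow_sum_of_pos hZ, hD, Real.rpow_natCast, div_eq_inv_mul]

lemma prod_gam {k : ℕ} {c θ : Fin k → ℝ} :
    ∏ i, gam (θ i) ^ c i = Real.exp (-(∑ i, c i * θ i ^ 2) / 2) := by
  unfold gam
  simp_rw [← Real.exp_mul]
  rw [← Real.exp_sum]
  congr 1
  rw [neg_div, Finset.sum_div, ← Finset.sum_neg_distrib]
  exact Finset.sum_congr rfl fun i _ => by ring

lemma norm_sq_frame_sum_le {E : Type*} [NormedAddCommGroup E] [InnerProductSpace ℝ E] {k : ℕ}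
    {u : Fin k → E} {c : Fin k → ℝ} (hc : ∀ i, 0 < c i)
    (hiso : ∀ x, ∑ i, c i * ⟪u i, x⟫ ^ 2 = ‖x‖ ^ 2) (θ : Fin k → ℝ) :
    ‖∑ i, (c i * θ i) • u i‖ ^ 2 ≤ ∑ i, c i * θ i ^ 2 := by
  set X := ∑ i, (c i * θ i) • u i with hX
  have h1 : ∑ i, c i * (θ i * ⟪u i, X⟫) = ‖X‖ ^ 2 := by
    rw [← real_inner_self_eq_norm_sq]
    conv_rhs => rw [hX, sum_inner]
    refine Finset.sum_congr rfl fun i _ => ?_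
    rw [real_inner_smul_left]; ring
  have h2 : 0 ≤ ∑ i, c i * (θ i - ⟪u i, X⟫) ^ 2 :=
    Finset.sum_nonneg fun i _ => mul_nonneg (hc i).le (sq_nonneg _)
  have h3 : ∑ i, c i * (θ i - ⟪u i, X⟫) ^ 2 = ∑ i, c i * θ i ^ 2 -
      2 * ∑ i, c i * (θ i * ⟪u i, X⟫) + ∑ i, c i * ⟪u i, X⟫ ^ 2 := by
    rw [Finset.mul_sum, ← Finset.sum_sub_distrib, ← Finset.sum_add_distrib]
    exact Finset.sum_congr rfl fun i _ => by ring
  rw [h3, h1, hiso] at h2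
  linarith

lemma prod_trunc_measurable {E : Type*} [NormedAddCommGroup E] [InnerProductSpace ℝ E]
    [MeasurableSpace E] [BorelSpace E] [FiniteDimensional ℝ E] {k : ℕ} (u : Fin k → E) (c : Fin k → ℝ) (s : ℝ) :
    Measurable fun x : E => ∏ i, truncGaussU s ⟪x, u i⟫ ^ c i := by
  apply Finset.measurable_prod
  intro i _
  have : Measurable fun x : E => ⟪x, u i⟫ := by
    apply Continuous.measurable; fun_prop
  exact (truncGaussU_measurable.comp this).pow_const _

lemma lintegral_slab {E : Type*} [NormedAddCommGroup E] [InnerProductSpace ℝ E]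
    [MeasurableSpace E] [BorelSpace E] [FiniteDimensional ℝ E] {k : ℕ} {u : Fin k → E}
    (hu : ∀ i, ‖u i‖ = 1) {c : Fin k → ℝ} (hc : ∀ i, 0 < c i) (s Z : ℝ) :
    ∫⁻ x : E, ENNReal.ofReal (∏ i, (truncGaussU s ⟪x, u i⟫ / Z) ^ c i) ≤
      ∫⁻ x in slab u (Ioi 0), ENNReal.ofReal (∏ i, (truncGaussU s ⟪x, u i⟫ / Z) ^ c i) := by
  rw [← lintegral_indicator (isOpen_slab u isOpen_Ioi).measurableSet]
  apply lintegral_mono_ae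
  have h1 : ∀ᵐ x : E, ∀ i, ⟪x, u i⟫ ≠ 0 := by
    rw [ae_all_iff]
    intro i
    have h2 : volume (((innerSL ℝ (u i)).toLinearMap.ker : Submodule ℝ E) : Set E) = 0 := by
      apply Measure.addHaar_submodule
      intro htop
      have : u i ∈ (innerSL ℝ (u i)).toLinearMap.ker := by rw [htop]; trivial
      have h3 : ⟪u i, u i⟫ = 0 := this
      rw [real_inner_self_eq_norm_sq, hu] at h3
      norm_num at h3
    rw [ae_iff]
    refine measure_mono_null ?_ h2
    intro x hx
    have hx : ⟪x, u i⟫ = 0 := by simpa using hx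
    have : ⟪u i, x⟫ = 0 := by rw [real_inner_comm]; exact hx
    exact this
  filter_upwards [h1] with x hx
  by_cases hxs : x ∈ slab u (Ioi 0)
  · rw [indicator_of_mem hxs]
  · have : ∃ i, ¬ (0 < ⟪x, u i⟫) := by
      by_contra! hcon
      exact hxs hcon
    obtain ⟨i, hi⟩ := this
    have hi' : ⟪x, u i⟫ < 0 := lt_of_le_of_ne (not_lt.1 hi) (hx i)
    have h0 : ∏ i, (truncGaussU s ⟪x, u i⟫ / Z) ^ c i = 0 := by
      apply Finset.prod_eq_zero (Finset.mem_univ i)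
      simp [truncGaussU, not_le.2 hi', Real.zero_rpow (hc i).ne']
    rw [h0]; simp


lemma forward_ineq {n k : ℕ} (hn : 2 ≤ n) (hk0 : 0 < k) (hk : k ≤ 2 * n ^ 2)
    {e : EuclideanSpace ℝ (Fin (n + 1))}
    {u : Fin k → EuclideanSpace ℝ (Fin (n + 1))} (hu : ∀ i, ‖u i‖ = 1)
    (hue : ∀ i, ⟪u i, e⟫ = (√((n : ℝ) + 1))⁻¹)
    {c : Fin k → ℝ} (hc : ∀ i, 0 < c i) (hiso : ∀ x, ∑ i, c i * ⟪u i, x⟫ ^ 2 = ‖x‖ ^ 2)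
    (hD : ∑ i, c i = ((n + 1 : ℕ) : ℝ)) {s ρ : ℝ} (hs : s ∈ Icc (0 : ℝ) 0.15) {a b : Fin k}
    (ha : (k : ℝ)⁻¹ ≤ c a) (hb : (k : ℝ)⁻¹ ≤ c b) (hδ : (k : ℝ)⁻¹ ≤ ‖u a - u b‖ ^ 2)
    (hη : ρ ^ 2 / (64 * (n + 1)) < |⟪u a, u b⟫|) :
    (∫⁻ x, ENNReal.ofReal (∏ i, (truncGaussU s ⟪x, u i⟫ / (WW * NN s)) ^ c i)) +
      ENNReal.ofReal (((n : ℝ) ^ (56 * n))⁻¹ * ρ ^ 4) ≤ 1 := by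
  have hW := WW_pos
  have hN := NN_pos s
  have hk' : (0:ℝ) < k := by exact_mod_cast hk0
  have hsq : √((n : ℝ) + 1) ≠ 0 := by positivity
  obtain ⟨x₁, hx₁⟩ := barthe_quant hu hc hiso hD (I := Ioi 0) isOpen_Ioi (T := TT s) (T' := TT' s)
    (f := fun t => truncGaussU s t / (WW * NN s)) (h := fun y => gam y / WW)
    (fun t ht => TT_hasDerivAt ht) (fun t _ => TT'_pos t) TT_strictMonoOn
    (fun y => (div_pos (gam_pos y) hW).le)
    (fun t ht => by
      rw [truncGaussU_of_nonneg (le_of_lt ht), TT']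
      have := gam_pos (TT s t)
      field_simp)
    (truncGaussU_measurable.div_const _)
    (H := fun x => ENNReal.ofReal ((WW ^ (n + 1))⁻¹ * Real.exp (-‖x‖ ^ 2 / 2)))
    (fun x _ => by
      apply ENNReal.ofReal_le_ofReal
      rw [prod_div hD hW (fun i => (gam_pos _).le), prod_gam]
      apply mul_le_mul_of_nonneg_left _ (by positivity)
      apply Real.exp_le_exp.2
      have := norm_sq_frame_sum_le hc hiso (fun i => TT s ⟪x, u i⟫)
      linarith)
    (t₀ := s + 0.15) (r := 1/20) (M := 16) (κ := 1/25) (m := 1/4)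
    (x₀ := ((s + 0.15) * √((n : ℝ) + 1)) • e)
    (fun i => by
      rw [real_inner_smul_left, real_inner_comm, hue, mul_assoc, mul_inv_cancel₀ hsq, mul_one])
    (by norm_num) (by norm_num) (by norm_num)
    (fun t ht => by
      have := ht.1; have := hs.1
      simp only [mem_Ioi]; linarith)
    (fun t ht => TT'_upper hs ht) (fun t ht => p_lower hs ht)
    (fun t ht t' ht' => TT'_var hs ht ht')
    (a := a) (b := b) (d := (k : ℝ)⁻¹) (η := ρ ^ 2 / (64 * (n + 1))) (δ := √((k : ℝ)⁻¹))
    (by positivity) ha hb (by positivity) hη.le (by positivity)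
    (Real.sqrt_le_iff.2 ⟨norm_nonneg _, hδ⟩)
  rw [lintegral_gauss] at hx₁
  exact (add_le_add (lintegral_slab hu hc s _) (gain_bound hn hk0 hk x₁)).trans hx₁

lemma reverse_ineq {n k : ℕ} (hn : 2 ≤ n) (hk0 : 0 < k) (hk : k ≤ 2 * n ^ 2)
    {e : EuclideanSpace ℝ (Fin (n + 1))}
    {u : Fin k → EuclideanSpace ℝ (Fin (n + 1))} (hu : ∀ i, ‖u i‖ = 1)
    (hue : ∀ i, ⟪u i, e⟫ = (√((n : ℝ) + 1))⁻¹)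
    {c : Fin k → ℝ} (hc : ∀ i, 0 < c i) (hiso : ∀ x, ∑ i, c i * ⟪u i, x⟫ ^ 2 = ‖x‖ ^ 2)
    (hD : ∑ i, c i = ((n + 1 : ℕ) : ℝ)) {s ρ : ℝ} (hs : s ∈ Icc (0 : ℝ) 0.15) {a b : Fin k}
    (ha : (k : ℝ)⁻¹ ≤ c a) (hb : (k : ℝ)⁻¹ ≤ c b) (hδ : (k : ℝ)⁻¹ ≤ ‖u a - u b‖ ^ 2)
    (hη : ρ ^ 2 / (64 * (n + 1)) < |⟪u a, u b⟫|)
    {H : EuclideanSpace ℝ (Fin (n + 1)) → ℝ≥0∞}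
    (hH : ∀ θ : Fin k → ℝ, ENNReal.ofReal (∏ i, (truncGaussU s (θ i) / (WW * NN s)) ^ c i) ≤
      H (∑ i, (c i * θ i) • u i)) :
    1 + ENNReal.ofReal (((n : ℝ) ^ (56 * n))⁻¹ * ρ ^ 4) ≤ ∫⁻ x, H x := by
  have hW := WW_pos
  have hN := NN_pos s
  have hk' : (0:ℝ) < k := by exact_mod_cast hk0
  have hsq : √((n : ℝ) + 1) ≠ 0 := by positivity
  obtain ⟨x₁, hx₁⟩ := barthe_quant hu hc hiso hD (I := univ) isOpen_univ (T := SS s) (T' := SS' s)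
    (f := fun y => gam y / WW) (h := fun t => truncGaussU s t / (WW * NN s))
    (fun t _ => SS_hasDerivAt t) (fun t _ => SS'_pos t) (SS_strictMono.strictMonoOn _)
    (fun y => div_nonneg (truncGaussU_nonneg y) (by positivity))
    (fun t ht => by
      rw [truncGaussU_of_nonneg (SS_pos t).le, SS']
      have := gam_pos (SS s t - s)
      field_simp)
    (gam_cont.measurable.div_const _)
    (H := H)
    (fun x _ => hH fun i => SS s ⟪x, u i⟫)
    (t₀ := -0.15) (r := 1/20) (M := 16) (κ := 1/25) (m := 1/4)
    (x₀ := ((-0.15) * √((n : ℝ) + 1)) • e)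
    (fun i => by
      rw [real_inner_smul_left, real_inner_comm, hue, mul_assoc, mul_inv_cancel₀ hsq, mul_one])
    (by norm_num) (by norm_num) (by norm_num)
    (fun t ht => mem_univ _)
    (fun t ht => SS'_upper hs ht) (fun t ht => q_lower ht)
    (fun t ht t' ht' => SS'_var hs ht ht')
    (a := a) (b := b) (d := (k : ℝ)⁻¹) (η := ρ ^ 2 / (64 * (n + 1))) (δ := √((k : ℝ)⁻¹))
    (by positivity) ha hb (by positivity) hη.le (by positivity)
    (Real.sqrt_le_iff.2 ⟨norm_nonneg _, hδ⟩)
  have hslab : slab u univ = univ := by ext x; simp [slab]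
  have h1 : (∫⁻ x in slab u univ, ENNReal.ofReal (∏ i, (gam ⟪x, u i⟫ / WW) ^ c i)) = 1 := by
    rw [hslab, Measure.restrict_univ, ← lintegral_gauss n]
    congr 1; ext x
    rw [prod_div hD hW (fun i => (gam_pos _).le), prod_gam, ← hiso x]
    simp_rw [real_inner_comm]
  rw [h1] at hx₁
  exact (add_le_add le_rfl (gain_bound hn hk0 hk x₁)).trans hx₁

end assembly


theorem brascamp_lieb_and_reverse_stability
    (n k : ℕ) (hn : 1 ≤ n) (hk₁ : n + 1 ≤ k) (hk₂ : k ≤ 2 * n ^ 2)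
    (e : EuclideanSpace ℝ (Fin (n + 1))) (he : ‖e‖ = 1)
    (u : Fin k → EuclideanSpace ℝ (Fin (n + 1)))
    (hu : ∀ i, ‖u i‖ = 1) (hue : ∀ i, ⟪u i, e⟫ = 0)
    (c : Fin k → ℝ) (hc : ∀ i, 0 < c i)
    (hiso : ∀ x : EuclideanSpace ℝ (Fin (n + 1)),
      ⟪x, e⟫ = 0 → ‖x‖ ^ 2 = ∑ i, c i * ⟪u i, x⟫ ^ 2)
    (hcent : ∑ i, c i • u i = 0)
    (ut : Fin k → EuclideanSpace ℝ (Fin (n + 1)))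
    (hut : ∀ i, ut i = Real.sqrt ((n : ℝ) / (n + 1)) • u i + (Real.sqrt (n + 1))⁻¹ • e)
    (ct : Fin k → ℝ) (hct : ∀ i, ct i = ((n : ℝ) + 1) / n * c i)
    (s ρ : ℝ) (hs : s ∈ Icc (0 : ℝ) 0.15) (hρ0 : 0 < ρ) (hρ1 : ρ < 1)
    (hsep : ∀ w : Fin (n + 1) → EuclideanSpace ℝ (Fin (n + 1)),
      (∀ j, ‖w j‖ = 1) → (∀ j, ⟪w j, e⟫ = 0) →
      (∀ j j', j ≠ j' → ⟪w j, w j'⟫ = -1 / n) →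
      ∀ idx : Fin (n + 1) → Fin k, Function.Injective idx →
        ∃ j, ρ ≤ InnerProductGeometry.angle (u (idx j)) (w j)) :
    (∫ x, ∏ i, truncGaussU s ⟪x, ut i⟫ ^ ct i) ≤
      (1 - ((n : ℝ) ^ (56 * n))⁻¹ * ρ ^ 4) * (∫ t, truncGaussU s t) ^ (n + 1) ∧
    ENNReal.ofReal ((1 + ((n : ℝ) ^ (56 * n))⁻¹ * ρ ^ 4) * (∫ t, truncGaussU s t) ^ (n + 1)) ≤
      upperIntegral volume
        (fun x => ⨆ (θ : Fin k → ℝ) (_ : x = ∑ i, (ct i * θ i) • ut i),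
          ENNReal.ofReal (∏ i, truncGaussU s (θ i) ^ ct i)) := by
  have hn0 : (0 : ℝ) < n := by exact_mod_cast hn
  have hk0 : 0 < k := by omega
  have hct0 : ∀ i, 0 < ct i := fun i => by rw [hct]; have := hc i; positivity
  have hute : ∀ i, ⟪ut i, e⟫ = (√((n : ℝ) + 1))⁻¹ := fun i => tilde_norm he (hue i) (hut i)
  have hut1 : ∀ i, ‖ut i‖ = 1 := by
    intro i
    have := tilde_inner he (hue i) (hue i) (hut i) (hut i)
    rw [real_inner_self_eq_norm_sq, real_inner_self_eq_norm_sq, hu] at this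
    have h2 : ((n:ℝ) * 1 ^ 2 + 1) / (n + 1) = 1 := by field_simp
    rw [h2] at this
    nlinarith [norm_nonneg (ut i)]
  have hisot := tilde_iso hn he hu hue hiso hcent hut hct
  have hD : ∑ i, ct i = ((n + 1 : ℕ) : ℝ) := by
    simp_rw [hct]
    rw [← Finset.mul_sum, sum_coeff he hu hue hiso]
    push_cast; field_simp
  obtain ⟨a, b, ha, hb, hδ, hη⟩ := exists_pair hn he hu hue hut hut1 hct0 hisot hρ0 hρ1 hsep
  have hn2 : 2 ≤ n := by
    by_contra hlt
    obtain rfl : n = 1 := by omega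
    have hab : u a ≠ u b := by
      intro hab
      have hk' : (0:ℝ) < (k:ℝ)⁻¹ := by positivity
      rw [hut a, hut b, hab, sub_self, norm_zero, zero_pow two_ne_zero] at hδ
      linarith
    have h1 := not_one he hu hue hc hiso a b hab
    have h2 := tilde_inner he (hue a) (hue b) (hut a) (hut b)
    rw [h1] at h2
    rw [h2] at hη
    norm_num at hη
    nlinarith
  have hW := WW_pos
  have hN := NN_pos s
  set Z := WW * NN s with hZdef
  have hZ : 0 < Z := by positivity
  set ε := ((n : ℝ) ^ (56 * n))⁻¹ * ρ ^ 4 with hε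
  have hε0 : 0 ≤ ε := by positivity
  rw [integral_truncGaussU, ← hZdef]
  constructor
  · have h1 := forward_ineq hn2 hk0 hk₂ hut1 hute hct0 hisot hD hs ha hb hδ hη
    rw [← hZdef, ← hε] at h1
    set F : EuclideanSpace ℝ (Fin (n + 1)) → ℝ :=
      fun x => ∏ i, (truncGaussU s ⟪x, ut i⟫ / Z) ^ ct i with hF
    have hFe : ∀ x, ∏ i, truncGaussU s ⟪x, ut i⟫ ^ ct i = Z ^ (n + 1) * F x := by
      intro x
      rw [hF]; simp only
      rw [prod_div hD hZ (fun i => truncGaussU_nonneg _), mul_inv_cancel_left₀ (by positivity)]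
    have hF0 : ∀ x, 0 ≤ F x := fun x => Finset.prod_nonneg fun i _ =>
      Real.rpow_nonneg (div_nonneg (truncGaussU_nonneg _) hZ.le) _
    have hFm : Measurable F := by
      have : F = fun x => (Z ^ (n + 1))⁻¹ * ∏ i, truncGaussU s ⟪x, ut i⟫ ^ ct i := by
        ext x; exact prod_div hD hZ (fun i => truncGaussU_nonneg _)
      rw [this]
      exact (prod_trunc_measurable ut ct s).const_mul _
    have hI : ∫ x, F x ≤ 1 - ε := by
      rw [integral_eq_lintegral_of_nonneg_ae (Filter.Eventually.of_forall hF0)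
        hFm.aestronglyMeasurable]
      have hfin : (∫⁻ x, ENNReal.ofReal (F x)) ≠ ⊤ :=
        ne_top_of_le_ne_top ENNReal.one_ne_top (le_self_add.trans h1)
      have h2 := ENNReal.toReal_mono ENNReal.one_ne_top h1
      rw [ENNReal.toReal_add hfin ENNReal.ofReal_ne_top, ENNReal.toReal_ofReal hε0,
        ENNReal.toReal_one] at h2
      linarith
    simp_rw [hFe]
    rw [integral_const_mul, mul_comm]
    exact mul_le_mul_of_nonneg_right hI (by positivity)
  · refine le_iInf fun g => le_iInf fun hg => le_iInf fun hdom => ?_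
    have hC0 : ENNReal.ofReal (Z ^ (n + 1)) ≠ 0 := (ENNReal.ofReal_pos.2 (by positivity)).ne'
    have h1 := reverse_ineq hn2 hk0 hk₂ hut1 hute hct0 hisot hD hs ha hb hδ hη
      (H := fun x => (ENNReal.ofReal (Z ^ (n + 1)))⁻¹ * g x) (fun θ => by
        rw [prod_div hD hZ (fun i => truncGaussU_nonneg _), ENNReal.ofReal_mul (by positivity),
          ENNReal.ofReal_inv_of_pos (by positivity)]
        apply mul_le_mul_right
        refine le_trans ?_ (hdom _)
        exact le_iSup₂_of_le (f := fun (θ' : Fin k → ℝ)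
          (_ : ∑ i, (ct i * θ i) • ut i = ∑ i, (ct i * θ' i) • ut i) =>
          ENNReal.ofReal (∏ i, truncGaussU s (θ' i) ^ ct i)) θ rfl le_rfl)
    rw [← hε, lintegral_const_mul _ hg] at h1
    rw [ENNReal.ofReal_mul (by positivity), ENNReal.ofReal_add zero_le_one hε0, ENNReal.ofReal_one]
    calc (1 + ENNReal.ofReal ε) * ENNReal.ofReal (Z ^ (n + 1))
        ≤ ((ENNReal.ofReal (Z ^ (n + 1)))⁻¹ * ∫⁻ x, g x) * ENNReal.ofReal (Z ^ (n + 1)) :=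
          mul_le_mul_left h1 _
      _ = ∫⁻ x, g x := by
          rw [mul_comm, ← mul_assoc, ENNReal.mul_inv_cancel hC0 ENNReal.ofReal_ne_top, one_mul]

end
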